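/- arXiv:1207.4856 — 2 statements merged into one kernel-verified Lean document; each statement's English description precedes it below -/
import Mathlib

section
/- For a Nakayama algebra, a module E is elementary (nonzero Gorenstein projective, non-projective, with no proper nonzero Gorenstein projective factor module) if and only if E is nonzero Gorenstein projective non-projective with no proper nonzero Gorenstein projective submodule. -/
universe u

variable (Λ : Type u) [Ring Λ]

section BasicDefs

variable (M : Type u) [AddCommGroup M] [Module Λ M]

/-- A module is uniserial if its submodules are linearly ordered by inclusion. -/
def IsUniserialMod : Prop := ∀ N N' : Submodule Λ M, N ≤ N' ∨ N' ≤ N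

/-- A module is indecomposable if it is nonzero and admits no nontrivial direct sum
decomposition. -/
def IsIndecomposableMod : Prop :=
  Nontrivial M ∧ ∀ N N' : Submodule Λ M, IsCompl N N' → N = ⊥ ∨ N' = ⊥

/-- The radical of a module: the intersection of all maximal submodules. -/
def modRadical : Submodule Λ M := sInf {N : Submodule Λ M | IsCoatom N}

/-- The socle of a module: the sum of all simple submodules. -/
def modSocle : Submodule Λ M := sSup {N : Submodule Λ M | IsAtom N}

/-- `HasLength Λ M n` : the module `M` has a composition series of length `n`. -/
def HasLength (n : ℕ) : Prop :=
  ∃ c : Fin (n + 1) → Submodule Λ M,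
    c 0 = ⊥ ∧ c (Fin.last n) = ⊤ ∧ ∀ i : Fin n, c i.castSucc ⋖ c i.succ

end BasicDefs

/-- A Nakayama algebra: an artinian ring all of whose finite-length indecomposable
(left) modules are uniserial. -/
class IsNakayama : Prop where
  artinian : IsArtinianRing Λ
  serial : ∀ (M : Type u) [AddCommGroup M] [Module Λ M],
    (∃ n, HasLength Λ M n) → IsIndecomposableMod Λ M → IsUniserialMod Λ M

/-- `Λ` has no simple projective module. -/
def NoSimpleProjectives : Prop :=
  ∀ (M : Type u) [AddCommGroup M] [Module Λ M], IsSimpleModule Λ M → ¬ Module.Projective Λ M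

/-- `Λ` is connected: no nontrivial central idempotents. -/
def IsConnectedAlg : Prop :=
  ∀ e : Λ, IsIdempotentElem e → (∀ x : Λ, e * x = x * e) → e = 0 ∨ e = 1

section Covers

variable {Λ}
variable {P M : Type u} [AddCommGroup P] [Module Λ P] [AddCommGroup M] [Module Λ M]

/-- `p : P → M` is a projective cover: `P` projective, `p` surjective with superfluous
kernel. -/
structure IsProjCover (p : P →ₗ[Λ] M) : Prop where
  projective : Module.Projective Λ P
  surjective : Function.Surjective p
  superfluous : LinearMap.ker p ≤ modRadical Λ P

end Covers

/-- `S` is (isomorphic to) the top `M/rad M` of `M`, and is simple. -/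
def IsTopOf (S M : Type u) [AddCommGroup S] [Module Λ S] [AddCommGroup M] [Module Λ M] :
    Prop :=
  IsSimpleModule Λ S ∧
    ∃ p : M →ₗ[Λ] S, Function.Surjective p ∧ LinearMap.ker p = modRadical Λ M

/-- `S` is (isomorphic to) the socle of `M`. -/
def IsSocleOf (S M : Type u) [AddCommGroup S] [Module Λ S] [AddCommGroup M] [Module Λ M] :
    Prop :=
  ∃ i : S →ₗ[Λ] M, Function.Injective i ∧ LinearMap.range i = modSocle Λ M

/-- `IsTauOf Λ T S` : `T` is the Auslander–Reiten translate `τ S` of the simple module `S`;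
for a Nakayama algebra without simple projectives this means there is a length-2 module
with top `S` and socle `T`. -/
def IsTauOf (T S : Type u) [AddCommGroup T] [Module Λ T] [AddCommGroup S] [Module Λ S] :
    Prop :=
  IsSimpleModule Λ S ∧ IsSimpleModule Λ T ∧
    ∃ L : ModuleCat.{u} Λ, HasLength Λ L 2 ∧ IsTopOf Λ S L ∧ IsSocleOf Λ T L

/-- `GammaRel Λ S T` : `T = γ S = τ soc P(S)` in the resolution quiver. -/
def GammaRel (S T : Type u) [AddCommGroup S] [Module Λ S] [AddCommGroup T] [Module Λ T] :
    Prop :=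
  IsSimpleModule Λ S ∧
    ∃ (P : ModuleCat.{u} Λ) (p : P →ₗ[Λ] S), IsProjCover p ∧
      ∃ V : ModuleCat.{u} Λ, IsSimpleModule Λ V ∧ IsSocleOf Λ V P ∧ IsTauOf Λ T V

/-- A simple module is black if its projective dimension is at least 2, i.e. the kernel of
its projective cover is not projective. -/
def IsBlackSimple (S : Type u) [AddCommGroup S] [Module Λ S] : Prop :=
  IsSimpleModule Λ S ∧
    ∀ (P : ModuleCat.{u} Λ) (p : P →ₗ[Λ] S), IsProjCover p →
      ¬ Module.Projective Λ (LinearMap.ker p)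

/-- A simple module is red if it has projective dimension exactly 1, i.e. the kernel of its
projective cover is projective. -/
def IsRedSimple (S : Type u) [AddCommGroup S] [Module Λ S] : Prop :=
  IsSimpleModule Λ S ∧
    ∃ (P : ModuleCat.{u} Λ) (p : P →ₗ[Λ] S), IsProjCover p ∧
      Module.Projective Λ (LinearMap.ker p)

/-- A simple module is cyclically black if it lies on a cycle of the resolution quiver all
of whose vertices are black. -/
def IsCyclicallyBlack (S : Type u) [AddCommGroup S] [Module Λ S] : Prop :=
  ∃ (n : ℕ) (C : ℕ → ModuleCat.{u} Λ), 0 < n ∧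
    Nonempty ((C 0 : Type u) ≃ₗ[Λ] S) ∧ Nonempty ((C n : Type u) ≃ₗ[Λ] S) ∧
    (∀ i < n, GammaRel Λ (C i) (C (i + 1))) ∧ ∀ i ≤ n, IsBlackSimple Λ (C i)

/-- An indecomposable projective module is minimal projective if its radical is not
projective. -/
def IsMinimalProjective (P : Type u) [AddCommGroup P] [Module Λ P] : Prop :=
  Module.Projective Λ P ∧ IsIndecomposableMod Λ P ∧
    ¬ Module.Projective Λ (modRadical Λ P)

/-- `M` is Gorenstein projective: it is an image in a complete projective resolution, i.e.
an exact complex of projectives which stays exact after applying `Hom(-, Λ)`. -/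
def IsGorensteinProjective (M : Type u) [AddCommGroup M] [Module Λ M] : Prop :=
  ∃ (P : ℤ → ModuleCat.{u} Λ) (d : ∀ i, P (i + 1) →ₗ[Λ] P i),
    (∀ i, Module.Projective Λ (P i)) ∧
    (∀ i, Function.Exact (d (i + 1)) (d i)) ∧
    (∀ (i : ℤ) (φ : P (i + 1) →ₗ[Λ] Λ), φ.comp (d (i + 1)) = 0 →
      ∃ ψ : P i →ₗ[Λ] Λ, ψ.comp (d i) = φ) ∧
    Nonempty (M ≃ₗ[Λ] LinearMap.range (d 0))

/-- `M` has a finite projective resolution. -/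
def HasFinitePD (M : Type u) [AddCommGroup M] [Module Λ M] : Prop :=
  ∃ (n : ℕ) (P : ℕ → ModuleCat.{u} Λ) (d : ∀ i, P (i + 1) →ₗ[Λ] P i)
      (ε : P 0 →ₗ[Λ] M),
    (∀ i, Module.Projective Λ (P i)) ∧ Function.Surjective ε ∧
    Function.Exact (d 0) ε ∧ (∀ i, Function.Exact (d (i + 1)) (d i)) ∧
    ∀ i, n < i → Subsingleton (P i)

/-- `M` has injective dimension at most `n` (over the ring `Λ`). -/
def InjDimLE (M : Type u) [AddCommGroup M] [Module Λ M] (n : ℕ) : Prop :=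
  ∃ (I : ℕ → ModuleCat.{u} Λ) (η : M →ₗ[Λ] I 0) (d : ∀ i, I i →ₗ[Λ] I (i + 1)),
    (∀ i, Module.Injective Λ (I i)) ∧ Function.Injective η ∧
    Function.Exact η (d 0) ∧ (∀ i, Function.Exact (d i) (d (i + 1))) ∧
    ∀ i, n < i → Subsingleton (I i)

/-- `Λ` is a Gorenstein algebra: finite injective dimension as a left and right module
over itself. -/
def IsGorensteinAlg : Prop :=
  (∃ n, InjDimLE Λ Λ n) ∧ ∃ n, InjDimLE Λᵐᵒᵖ Λ n

/-- Every cycle of the resolution quiver consists of black vertices. -/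
def AllCyclesBlack : Prop :=
  ∀ (n : ℕ) (C : ℕ → ModuleCat.{u} Λ), 0 < n →
    (∀ i < n, GammaRel Λ (C i) (C (i + 1))) →
    Nonempty ((C n : Type u) ≃ₗ[Λ] (C 0 : Type u)) →
    ∀ i ≤ n, IsBlackSimple Λ (C i)

/-- Every cycle of the resolution quiver contains a red vertex. -/
def EveryCycleHasRed : Prop :=
  ∀ (n : ℕ) (C : ℕ → ModuleCat.{u} Λ), 0 < n →
    (∀ i < n, GammaRel Λ (C i) (C (i + 1))) →
    Nonempty ((C n : Type u) ≃ₗ[Λ] (C 0 : Type u)) →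
    ∃ i ≤ n, IsRedSimple Λ (C i)

/-- `Λ` is CM-free: every finite-length Gorenstein projective module is projective. -/
def IsCMFree : Prop :=
  ∀ (M : Type u) [AddCommGroup M] [Module Λ M],
    (∃ n, HasLength Λ M n) → IsGorensteinProjective Λ M → Module.Projective Λ M

/-- `Λ` has exactly `s` isomorphism classes of simple modules. -/
def SimpleCount (s : ℕ) : Prop :=
  ∃ F : Fin s → ModuleCat.{u} Λ,
    (∀ i, IsSimpleModule Λ (F i)) ∧
    (∀ i j, i ≠ j → IsEmpty ((F i : Type u) ≃ₗ[Λ] (F j : Type u))) ∧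
    ∀ (S : Type u) [AddCommGroup S] [Module Λ S], IsSimpleModule Λ S →
      ∃ i, Nonempty (S ≃ₗ[Λ] (F i : Type u))

/-- Every (finite length) indecomposable projective module has length `> s`;
this is the condition `p > s`. -/
def MinProjLengthGT (s : ℕ) : Prop :=
  ∀ (P : Type u) [AddCommGroup P] [Module Λ P],
    Module.Projective Λ P → IsIndecomposableMod Λ P →
      ∀ n, HasLength Λ P n → s < n

/-- An elementary Gorenstein projective module: nonzero, Gorenstein projective,
non-projective, and no proper nonzero factor module is Gorenstein projective. -/
def IsElementary (E : Type u) [AddCommGroup E] [Module Λ E] : Prop :=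
  Nontrivial E ∧ (∃ n, HasLength Λ E n) ∧ IsGorensteinProjective Λ E ∧
    ¬ Module.Projective Λ E ∧
    ∀ N : Submodule Λ E, N ≠ ⊥ → N ≠ ⊤ → ¬ IsGorensteinProjective Λ (E ⧸ N)

/-- `m` is the multiplicity of the simple module `S` as a composition factor of `M`. -/
def MultiplicityOf (S M : Type u) [AddCommGroup S] [Module Λ S] [AddCommGroup M]
    [Module Λ M] (m : ℕ) : Prop :=
  ∃ (n : ℕ) (c : Fin (n + 1) → Submodule Λ M),
    c 0 = ⊥ ∧ c (Fin.last n) = ⊤ ∧ (∀ i : Fin n, c i.castSucc ⋖ c i.succ) ∧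
    m = Nat.card {i : Fin n //
      Nonempty ((↥(c i.succ) ⧸ (c i.castSucc).comap (c i.succ).subtype) ≃ₗ[Λ] S)}

/-- From `S`, the cycles of the resolution quiver can be reached (in a black-cycle vertex)
in `m` steps. -/
def ReachesBlackIn (S : Type u) [AddCommGroup S] [Module Λ S] (m : ℕ) : Prop :=
  ∃ C : ℕ → ModuleCat.{u} Λ, Nonempty ((C 0 : Type u) ≃ₗ[Λ] S) ∧
    (∀ i < m, GammaRel Λ (C i) (C (i + 1))) ∧ IsCyclicallyBlack Λ (C m)

/-- `d` is the maximal distance of a vertex of the resolution quiver to the black cycles. -/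
def MaxDistToBlack (d : ℕ) : Prop :=
  (∀ (S : Type u) [AddCommGroup S] [Module Λ S], IsSimpleModule Λ S →
      ∃ m ≤ d, ReachesBlackIn Λ S m) ∧
  ∃ S : ModuleCat.{u} Λ, IsSimpleModule Λ S ∧ ∀ m < d, ¬ ReachesBlackIn Λ (S : Type u) m

namespace GPAux

section Machinery

variable {Λ}

/-- Every linear form on `A` extends along `i : A → P`. -/
def LExt {A P : Type u} [AddCommGroup A] [Module Λ A] [AddCommGroup P] [Module Λ P]
    (i : A →ₗ[Λ] P) : Prop :=
  ∀ φ : A →ₗ[Λ] Λ, ∃ ψ : P →ₗ[Λ] Λ, ψ ∘ₗ i = φ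

/-- There is a short exact sequence `0 → A → P → B → 0`, `P` projective, such that linear forms
on `A` extend to `P`. -/
def Rel (A B : Type u) [AddCommGroup A] [Module Λ A] [AddCommGroup B] [Module Λ B] : Prop :=
  ∃ (P : ModuleCat.{u} Λ) (ι : A →ₗ[Λ] P) (π : P →ₗ[Λ] B), Module.Projective Λ P ∧
    Function.Injective ι ∧ Function.Surjective π ∧ Function.Exact ι π ∧ LExt ι

theorem Rel.congr {A B A' B' : Type u} [AddCommGroup A] [Module Λ A] [AddCommGroup B] [Module Λ B]
    [AddCommGroup A'] [Module Λ A'] [AddCommGroup B'] [Module Λ B']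
    (h : Rel (Λ := Λ) A B) (e : A' ≃ₗ[Λ] A) (f : B' ≃ₗ[Λ] B) : Rel (Λ := Λ) A' B' := by
  obtain ⟨P, ι, π, hP, hi, hs, he, hx⟩ := h
  refine ⟨P, ι ∘ₗ e.toLinearMap, f.symm.toLinearMap ∘ₗ π, hP, hi.comp e.injective,
    f.symm.surjective.comp hs, ?_, ?_⟩
  · intro x
    simp only [LinearMap.comp_apply, LinearEquiv.coe_coe, LinearEquiv.map_eq_zero_iff, he x]
    constructor
    · rintro ⟨a, rfl⟩; exact ⟨e.symm a, by simp⟩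
    · rintro ⟨a, rfl⟩; exact ⟨e a, rfl⟩
  · intro φ
    obtain ⟨ψ, hψ⟩ := hx (φ ∘ₗ e.symm.toLinearMap)
    refine ⟨ψ, ?_⟩
    ext a
    have := LinearMap.congr_fun hψ (e a)
    simpa using this

theorem gp_congr {M M' : Type u} [AddCommGroup M] [Module Λ M] [AddCommGroup M'] [Module Λ M']
    (e : M ≃ₗ[Λ] M') (h : IsGorensteinProjective Λ M) : IsGorensteinProjective Λ M' := by
  obtain ⟨P, d, h1, h2, h3, ⟨f⟩⟩ := h
  exact ⟨P, d, h1, h2, h3, ⟨e.symm.trans f⟩⟩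

theorem gp_class {M : Type u} [AddCommGroup M] [Module Λ M] (h : IsGorensteinProjective Λ M) :
    ∃ G : ModuleCat.{u} Λ → Prop, G (ModuleCat.of Λ M) ∧
      (∀ X, G X → ∃ Y, G Y ∧ Rel (Λ := Λ) X Y) ∧ (∀ X, G X → ∃ Y, G Y ∧ Rel (Λ := Λ) Y X) := by
  obtain ⟨P, d, h1, h2, h3, ⟨f⟩⟩ := h
  have key : ∀ i, Rel (Λ := Λ) (LinearMap.range (d (i + 1))) (LinearMap.range (d i)) := by
    intro i
    refine ⟨P (i + 1), (LinearMap.range (d (i + 1))).subtype, (d i).rangeRestrict, h1 _,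
      Subtype.val_injective, LinearMap.surjective_rangeRestrict _, ?_, ?_⟩
    · intro x
      have := h2 i x
      simp only [Submodule.coe_subtype, Subtype.range_coe_subtype, LinearMap.mem_range,
        Set.mem_ofPred_eq]
      rw [← Set.mem_range, ← this, ← Subtype.coe_inj]
      rfl
    · intro φ
      obtain ⟨ψ, hψ⟩ := h3 (i + 1) (φ ∘ₗ (d (i + 1)).rangeRestrict) (by
        ext x
        have h0 : d (i + 1) (d (i + 1 + 1) x) = 0 := (h2 (i + 1)).apply_apply_eq_zero x
        have : (d (i + 1)).rangeRestrict (d (i + 1 + 1) x) = 0 := Subtype.ext h0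
        simp [this])
      refine ⟨ψ, ?_⟩
      ext ⟨x, y, rfl⟩
      exact LinearMap.congr_fun hψ y
  refine ⟨fun X => ∃ i, Nonempty (X ≃ₗ[Λ] LinearMap.range (d i)), ⟨0, ⟨f⟩⟩, ?_, ?_⟩
  · rintro X ⟨i, ⟨e⟩⟩
    obtain ⟨j, rfl⟩ : ∃ j, i = j + 1 := ⟨i - 1, by ring⟩
    exact ⟨ModuleCat.of Λ (LinearMap.range (d j)), ⟨j, ⟨LinearEquiv.refl _ _⟩⟩,
      (key j).congr e (LinearEquiv.refl _ _)⟩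
  · rintro X ⟨i, ⟨e⟩⟩
    exact ⟨ModuleCat.of Λ (LinearMap.range (d (i + 1))), ⟨i + 1, ⟨LinearEquiv.refl _ _⟩⟩,
      (key i).congr (LinearEquiv.refl _ _) e⟩

theorem gp_of_seq (Z : ℤ → ModuleCat.{u} Λ)
    (hZ : ∀ i, Rel (Λ := Λ) (Z (i + 1)) (Z i)) :
    IsGorensteinProjective Λ (Z (0 + 1)) := by
  choose P ι π hP hi hs he hx using hZ
  refine ⟨P, fun i => ι i ∘ₗ π (i + 1), hP, ?_, ?_, ?_⟩
  · intro i x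
    have h1 : (ι i ∘ₗ π (i + 1)) x = 0 ↔ π (i + 1) x = 0 := by
      rw [LinearMap.comp_apply, map_eq_zero_iff _ (hi i)]
    rw [h1, he (i + 1) x]
    constructor
    · rintro ⟨y, rfl⟩
      obtain ⟨z, rfl⟩ := hs _ y
      exact ⟨z, rfl⟩
    · rintro ⟨y, rfl⟩
      exact ⟨_, rfl⟩
  · intro i φ hφ
    have hk : ∀ y, φ (ι (i + 1) y) = 0 := by
      intro y
      obtain ⟨z, rfl⟩ := hs _ y
      exact LinearMap.congr_fun hφ z
    have hker : LinearMap.ker (π (i + 1)) ≤ LinearMap.ker φ := by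
      intro x hx
      obtain ⟨y, rfl⟩ := (he (i + 1) x).1 hx
      exact hk y
    obtain ⟨ψ, hψ⟩ := hx i ((LinearMap.ker (π (i + 1))).liftQ φ hker ∘ₗ
      ((π (i + 1)).quotKerEquivOfSurjective (hs _)).symm.toLinearMap)
    refine ⟨ψ, ?_⟩
    ext x
    have := LinearMap.congr_fun hψ (π (i + 1) x)
    simp only [LinearMap.comp_apply] at this ⊢
    rw [this]
    have h2 : ((π (i + 1)).quotKerEquivOfSurjective (hs _)).symm (π (i + 1) x) =
      Submodule.Quotient.mk x := by
      rw [LinearEquiv.symm_apply_eq]; rfl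
    simp [h2]
  · have : LinearMap.range (ι 0 ∘ₗ π (0 + 1)) = LinearMap.range (ι 0) := by
      rw [LinearMap.range_comp, LinearMap.range_eq_top.2 (hs _), Submodule.map_top]
    exact ⟨(LinearEquiv.ofInjective (ι 0) (hi 0)).trans (LinearEquiv.ofEq _ _ this.symm)⟩

theorem gp_of_class (G : ModuleCat.{u} Λ → Prop)
    (hs : ∀ X, G X → ∃ Y, G Y ∧ Rel (Λ := Λ) X Y) (hp : ∀ X, G X → ∃ Y, G Y ∧ Rel (Λ := Λ) Y X)
    {M : Type u} [AddCommGroup M] [Module Λ M] (hM : G (ModuleCat.of Λ M)) :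
    IsGorensteinProjective Λ M := by
  have hs' : ∀ X : {X // G X}, ∃ Y : {X // G X}, Rel (Λ := Λ) X.1 Y.1 := fun X => by
    obtain ⟨Y, h, h'⟩ := hs X.1 X.2
    exact ⟨⟨Y, h⟩, h'⟩
  have hp' : ∀ X : {X // G X}, ∃ Y : {X // G X}, Rel (Λ := Λ) Y.1 X.1 := fun X => by
    obtain ⟨Y, h, h'⟩ := hp X.1 X.2
    exact ⟨⟨Y, h⟩, h'⟩
  choose s hs using hs'
  choose p hp using hp'
  let x0 : {X // G X} := ⟨ModuleCat.of Λ M, hM⟩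
  let Z : ℤ → {X // G X} := fun i => match i with
    | Int.ofNat n => p^[n] x0
    | Int.negSucc n => s^[n + 1] x0
  have hZ : ∀ i, Rel (Λ := Λ) (Z (i + 1)).1 (Z i).1 := by
    intro i
    match i with
    | Int.ofNat n =>
      have : Z (Int.ofNat n + 1) = p (Z (Int.ofNat n)) :=
        Function.iterate_succ_apply' p n x0
      rw [this]; exact hp _
    | Int.negSucc 0 => exact hs _
    | Int.negSucc (n + 1) =>
      have : Z (Int.negSucc (n + 1)) = s (Z (Int.negSucc n)) :=
        Function.iterate_succ_apply' s (n + 1) x0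
      rw [this]
      exact hs _
  have := gp_of_seq (fun i => (Z (i - 1)).1) (fun i => by
    have := hZ (i - 1)
    rw [show i - 1 + 1 = i + 1 - 1 by ring] at this
    exact this)
  exact this

theorem gp_succ {M : Type u} [AddCommGroup M] [Module Λ M] (h : IsGorensteinProjective Λ M) :
    ∃ Y : ModuleCat.{u} Λ, IsGorensteinProjective Λ Y ∧ Rel (Λ := Λ) M Y := by
  obtain ⟨G, h0, hs, hp⟩ := gp_class h
  obtain ⟨Y, hY, hr⟩ := hs _ h0
  exact ⟨Y, gp_of_class G hs hp hY, hr⟩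

theorem gp_pred {M : Type u} [AddCommGroup M] [Module Λ M] (h : IsGorensteinProjective Λ M) :
    ∃ Y : ModuleCat.{u} Λ, IsGorensteinProjective Λ Y ∧ Rel (Λ := Λ) Y M := by
  obtain ⟨G, h0, hs, hp⟩ := gp_class h
  obtain ⟨Y, hY, hr⟩ := hp _ h0
  exact ⟨Y, gp_of_class G hs hp hY, hr⟩

/-- Two surjections with the same kernel have isomorphic targets. -/
theorem equiv_of_ker_eq {M A B : Type u} [AddCommGroup M] [Module Λ M] [AddCommGroup A]
    [Module Λ A] [AddCommGroup B] [Module Λ B] (f : M →ₗ[Λ] A) (g : M →ₗ[Λ] B)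
    (hf : Function.Surjective f) (hg : Function.Surjective g)
    (h : LinearMap.ker f = LinearMap.ker g) : Nonempty (A ≃ₗ[Λ] B) :=
  ⟨(f.quotKerEquivOfSurjective hf).symm.trans
    ((Submodule.quotEquivOfEq _ _ h).trans (g.quotKerEquivOfSurjective hg))⟩

/-- factor a map through a surjection -/
theorem factor {M A B : Type u} [AddCommGroup M] [Module Λ M] [AddCommGroup A]
    [Module Λ A] [AddCommGroup B] [Module Λ B] (f : M →ₗ[Λ] A) (g : M →ₗ[Λ] B)
    (hf : Function.Surjective f) (h : ∀ x, f x = 0 → g x = 0) :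
    ∃ k : A →ₗ[Λ] B, ∀ x, k (f x) = g x := by
  refine ⟨(LinearMap.ker f).liftQ g h ∘ₗ (f.quotKerEquivOfSurjective hf).symm.toLinearMap, ?_⟩
  intro x
  have h2 : (f.quotKerEquivOfSurjective hf).symm (f x) = Submodule.Quotient.mk x := by
    rw [LinearEquiv.symm_apply_eq]; rfl
  rw [LinearMap.comp_apply, LinearEquiv.coe_coe, h2]
  exact Submodule.liftQ_apply _ _ _

/-- adding a projective summand -/
theorem gp_prod {A Q : Type u} [AddCommGroup A] [Module Λ A] [AddCommGroup Q] [Module Λ Q]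
    (hA : IsGorensteinProjective Λ A) (hQ : Module.Projective Λ Q) :
    IsGorensteinProjective Λ (A × Q) := by
  refine gp_of_class (fun X => IsGorensteinProjective Λ X ∨ Nonempty (X ≃ₗ[Λ] (A × Q)))
    ?_ ?_ (Or.inr ⟨LinearEquiv.refl _ _⟩)
  · rintro X (hX | ⟨⟨e⟩⟩)
    · obtain ⟨Y, h, h'⟩ := gp_succ hX
      exact ⟨Y, Or.inl h, h'⟩
    · obtain ⟨Y, h, P, ι, π, hP, hi, hs, he, hx⟩ := gp_succ hA
      refine ⟨Y, Or.inl h, Rel.congr (A := A × Q) (B := Y) ?_ e (LinearEquiv.refl _ _)⟩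
      refine ⟨ModuleCat.of Λ (P × Q), ι.prodMap LinearMap.id, π ∘ₗ LinearMap.fst Λ P Q,
        inferInstanceAs (Module.Projective Λ (P × Q)), ?_, ?_, ?_, ?_⟩
      · rintro ⟨a, b⟩ ⟨c, d⟩ h
        simp only [LinearMap.prodMap_apply, Prod.mk.injEq, LinearMap.id_apply] at h
        exact Prod.ext (hi h.1) h.2
      · intro y
        obtain ⟨p, rfl⟩ := hs y
        exact ⟨(p, 0), rfl⟩
      · rintro ⟨p, q⟩
        simp only [LinearMap.comp_apply, LinearMap.fst_apply, he p]
        constructor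
        · rintro ⟨a, rfl⟩; exact ⟨(a, q), rfl⟩
        · rintro ⟨⟨a, q⟩, h⟩; exact ⟨a, congrArg Prod.fst h⟩
      · intro φ
        obtain ⟨ψ, hψ⟩ := hx (φ ∘ₗ LinearMap.inl Λ A Q)
        refine ⟨ψ.coprod (φ ∘ₗ LinearMap.inr Λ A Q), ?_⟩
        refine LinearMap.prod_ext ?_ ?_
        · ext a
          have h1 : ψ (ι a) = φ (a, 0) := LinearMap.congr_fun hψ a
          change ψ (ι a) + φ (0, 0) = φ (a, 0)
          rw [h1, Prod.mk_zero_zero, map_zero, add_zero]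
        · ext a
          simp
  · rintro X (hX | ⟨⟨e⟩⟩)
    · obtain ⟨Y, h, h'⟩ := gp_pred hX
      exact ⟨Y, Or.inl h, h'⟩
    · obtain ⟨Y, h, P, ι, π, hP, hi, hs, he, hx⟩ := gp_pred hA
      refine ⟨Y, Or.inl h, Rel.congr (A := Y) (B := A × Q) ?_ (LinearEquiv.refl _ _) e⟩
      refine ⟨ModuleCat.of Λ (P × Q), LinearMap.inl Λ P Q ∘ₗ ι, π.prodMap LinearMap.id,
        inferInstanceAs (Module.Projective Λ (P × Q)), ?_, ?_, ?_, ?_⟩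
      · exact LinearMap.inl_injective.comp hi
      · rintro ⟨y, q⟩
        obtain ⟨p, rfl⟩ := hs y
        exact ⟨(p, q), rfl⟩
      · rintro ⟨p, q⟩
        simp only [LinearMap.prodMap_apply, LinearMap.id_apply, Prod.mk_eq_zero, he p]
        constructor
        · rintro ⟨⟨a, rfl⟩, rfl⟩; exact ⟨a, rfl⟩
        · rintro ⟨a, h⟩; exact ⟨⟨a, congrArg Prod.fst h⟩, (congrArg Prod.snd h).symm⟩
      · intro φ
        obtain ⟨ψ, hψ⟩ := hx φ
        refine ⟨ψ ∘ₗ LinearMap.fst Λ P Q, ?_⟩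
        ext a
        exact LinearMap.congr_fun hψ a

/-- `Ext¹(X, Λ) = 0`: forms extend along any short exact sequence ending in `X`. -/
theorem Rel.lext {A X : Type u} [AddCommGroup A] [Module Λ A] [AddCommGroup X] [Module Λ X]
    (h : Rel (Λ := Λ) A X) {K M : Type u} [AddCommGroup K] [Module Λ K] [AddCommGroup M]
    [Module Λ M] (i : K →ₗ[Λ] M) (g : M →ₗ[Λ] X) (hi : Function.Injective i)
    (hg : Function.Surjective g) (he : Function.Exact i g) : LExt i := by
  obtain ⟨P, ι, π, hP, hιi, hs, hex, hx⟩ := h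
  intro φ
  obtain ⟨l, hl⟩ := Module.projective_lifting_property g π hg
  have hl' : ∀ p, g (l p) = π p := fun p => LinearMap.congr_fun hl p
  let iK := LinearEquiv.ofInjective i hi
  have hmem : ∀ a, l (ι a) ∈ LinearMap.range i := fun a => by
    have : g (l (ι a)) = 0 := by rw [hl']; exact hex.apply_apply_eq_zero a
    exact (he _).1 this
  let m : A →ₗ[Λ] K := iK.symm.toLinearMap ∘ₗ (l ∘ₗ ι).codRestrict _ hmem
  have hm : ∀ a, i (m a) = l (ι a) := fun a => by
    have : iK (m a) = (l ∘ₗ ι).codRestrict _ hmem a := by simp [m]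
    exact congrArg Subtype.val this
  obtain ⟨ψ, hψ⟩ := hx (φ ∘ₗ m)
  have hψ' : ∀ a, ψ (ι a) = φ (m a) := fun a => LinearMap.congr_fun hψ a
  let σ : (P × K) →ₗ[Λ] M := l.coprod i
  have hσ : Function.Surjective σ := by
    intro y
    obtain ⟨p, hp⟩ := hs (g y)
    have : g (y - l p) = 0 := by rw [map_sub, hl', hp, sub_self]
    obtain ⟨k, hk⟩ := (he _).1 this
    exact ⟨(p, k), by simp [σ, hk]⟩
  obtain ⟨χ, hχ⟩ := factor σ (ψ.coprod φ) hσ (by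
    rintro ⟨p, k⟩ h
    have h1 : l p + i k = 0 := by simpa [σ] using h
    have h2 : π p = 0 := by
      have := congrArg g h1
      rw [map_add, hl', he.apply_apply_eq_zero] at this
      simpa using this
    obtain ⟨a, rfl⟩ := (hex _).1 h2
    rw [← hm, ← map_add] at h1
    have h3 : m a + k = 0 := hi (by rw [h1, map_zero])
    change ψ (ι a) + φ k = 0
    rw [hψ', ← map_add, h3, map_zero])
  refine ⟨χ, ?_⟩
  ext k
  have := hχ (0, k)
  simpa [σ] using this

theorem LExt.finite_proj {K M Q : Type u} [AddCommGroup K] [Module Λ K] [AddCommGroup M]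
    [Module Λ M] [AddCommGroup Q] [Module Λ Q] {i : K →ₗ[Λ] M} (h : LExt i) [Module.Finite Λ Q]
    [Module.Projective Λ Q] (f : K →ₗ[Λ] Q) : ∃ g : M →ₗ[Λ] Q, g ∘ₗ i = f := by
  obtain ⟨n, p, hp⟩ := Module.Finite.exists_fin' Λ Q
  obtain ⟨s, hs⟩ := Module.projective_lifting_property p LinearMap.id hp
  choose ψ hψ using fun j : Fin n => h (LinearMap.proj j ∘ₗ s ∘ₗ f)
  refine ⟨p ∘ₗ LinearMap.pi ψ, ?_⟩
  ext k
  have : LinearMap.pi ψ (i k) = s (f k) := by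
    ext j
    exact LinearMap.congr_fun (hψ j) k
  rw [LinearMap.comp_apply, LinearMap.comp_apply, this]
  exact LinearMap.congr_fun hs (f k)

theorem dual_schanuel {X P Q C D : Type u} [AddCommGroup X] [Module Λ X] [AddCommGroup P]
    [Module Λ P] [AddCommGroup Q] [Module Λ Q] [AddCommGroup C] [Module Λ C] [AddCommGroup D]
    [Module Λ D] (a : X →ₗ[Λ] P) (b : X →ₗ[Λ] Q) (u : P →ₗ[Λ] Q) (v : Q →ₗ[Λ] P)
    (hu : ∀ x, u (a x) = b x) (hv : ∀ x, v (b x) = a x) (π : P →ₗ[Λ] C) (ρ : Q →ₗ[Λ] D)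
    (hπ : Function.Surjective π) (hρ : Function.Surjective ρ) (ha : Function.Exact a π)
    (hb : Function.Exact b ρ) : Nonempty ((D × P) ≃ₗ[Λ] (C × Q)) := by
  let Φ : (P × Q) →ₗ[Λ] (C × Q) := π.prodMap LinearMap.id
  let w : (P × Q) →ₗ[Λ] Q := u.coprod LinearMap.id
  let Ψ : (P × Q) →ₗ[Λ] (D × P) := (ρ ∘ₗ w).prod (LinearMap.fst Λ P Q - v ∘ₗ w)
  refine equiv_of_ker_eq Ψ Φ ?_ ?_ ?_
  · rintro ⟨d, p⟩
    obtain ⟨q, rfl⟩ := hρ d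
    refine ⟨(p + v q, q - u (p + v q)), ?_⟩
    simp [Ψ, w]
  · rintro ⟨c, q⟩
    obtain ⟨p, rfl⟩ := hπ c
    exact ⟨(p, q), rfl⟩
  · ext ⟨p, q⟩
    have e1 : (p, q) ∈ LinearMap.ker Ψ ↔ ρ (u p + q) = 0 ∧ p - v (u p + q) = 0 := by
      rw [LinearMap.mem_ker]; exact Prod.mk_eq_zero
    have e2 : (p, q) ∈ LinearMap.ker Φ ↔ π p = 0 ∧ q = 0 := by
      rw [LinearMap.mem_ker]; exact Prod.mk_eq_zero
    rw [e1, e2]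
    constructor
    · rintro ⟨h1, h2⟩
      obtain ⟨x, hx⟩ := (hb _).1 h1
      rw [← hx, hv, sub_eq_zero] at h2
      subst h2
      refine ⟨ha.apply_apply_eq_zero x, ?_⟩
      rw [hu] at hx
      simpa using hx
    · rintro ⟨h1, rfl⟩
      obtain ⟨x, rfl⟩ := (ha _).1 h1
      simp [hu, hv, hb.apply_apply_eq_zero x]

theorem schanuel {X P Q : Type u} [AddCommGroup X] [Module Λ X] [AddCommGroup P]
    [Module Λ P] [AddCommGroup Q] [Module Λ Q] [Module.Projective Λ P] [Module.Projective Λ Q]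
    (π : P →ₗ[Λ] X) (ρ : Q →ₗ[Λ] X) (hπ : Function.Surjective π) (hρ : Function.Surjective ρ) :
    Nonempty ((LinearMap.ker π × Q) ≃ₗ[Λ] (LinearMap.ker ρ × P)) := by
  obtain ⟨u, hu⟩ := Module.projective_lifting_property ρ π hρ
  obtain ⟨v, hv⟩ := Module.projective_lifting_property π ρ hπ
  have hu' : ∀ p, ρ (u p) = π p := fun p => LinearMap.congr_fun hu p
  have hv' : ∀ p, π (v p) = ρ p := fun p => LinearMap.congr_fun hv p
  let T := LinearMap.ker (π.coprod ρ)
  have e1 : Nonempty (T ≃ₗ[Λ] (LinearMap.ker π × Q)) := by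
    refine ⟨LinearEquiv.ofBijective ((((LinearMap.fst Λ P Q + v ∘ₗ LinearMap.snd Λ P Q) ∘ₗ
      T.subtype).codRestrict (LinearMap.ker π) ?_).prod (LinearMap.snd Λ P Q ∘ₗ T.subtype))
      ⟨?_, ?_⟩⟩
    · rintro ⟨⟨p, q⟩, h⟩
      have h : π p + ρ q = 0 := by simpa [T] using h
      simpa [hv'] using h
    · rw [← LinearMap.ker_eq_bot, LinearMap.ker_eq_bot']
      rintro ⟨⟨p, q⟩, h⟩ h'
      have h2 := congrArg Prod.snd h'
      have h1 := congrArg Subtype.val (congrArg Prod.fst h')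
      change q = 0 at h2
      subst h2
      change p + v 0 = 0 at h1
      rw [map_zero, add_zero] at h1
      subst h1
      rfl
    · rintro ⟨⟨k, hk⟩, q⟩
      refine ⟨⟨(k - v q, q), ?_⟩, ?_⟩
      · have hk : π k = 0 := hk
        simp [T, hk, hv']
      · refine Prod.ext (Subtype.ext ?_) rfl
        change k - v q + v q = k
        abel
  have e2 : Nonempty (T ≃ₗ[Λ] (LinearMap.ker ρ × P)) := by
    refine ⟨LinearEquiv.ofBijective ((((LinearMap.snd Λ P Q + u ∘ₗ LinearMap.fst Λ P Q) ∘ₗ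
      T.subtype).codRestrict (LinearMap.ker ρ) ?_).prod (LinearMap.fst Λ P Q ∘ₗ T.subtype))
      ⟨?_, ?_⟩⟩
    · rintro ⟨⟨p, q⟩, h⟩
      have h : π p + ρ q = 0 := by simpa [T] using h
      simpa [hu', add_comm] using h
    · rw [← LinearMap.ker_eq_bot, LinearMap.ker_eq_bot']
      rintro ⟨⟨p, q⟩, h⟩ h'
      have h2 := congrArg Prod.snd h'
      have h1 := congrArg Subtype.val (congrArg Prod.fst h')
      change p = 0 at h2
      subst h2
      change q + u 0 = 0 at h1
      rw [map_zero, add_zero] at h1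
      subst h1
      rfl
    · rintro ⟨⟨k, hk⟩, q⟩
      refine ⟨⟨(q, k - u q), ?_⟩, ?_⟩
      · have hk : ρ k = 0 := hk
        simp [T, hk, hu']
      · refine Prod.ext (Subtype.ext ?_) rfl
        change k - u q + u q = k
        abel
  exact ⟨e1.some.symm.trans e2.some⟩

/-- kernel description of the left term of an exact sequence -/
theorem equiv_ker {A P B : Type u} [AddCommGroup A] [Module Λ A] [AddCommGroup P]
    [Module Λ P] [AddCommGroup B] [Module Λ B] (ι : A →ₗ[Λ] P) (π : P →ₗ[Λ] B)
    (hi : Function.Injective ι) (he : Function.Exact ι π) :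
    Nonempty (A ≃ₗ[Λ] LinearMap.ker π) :=
  ⟨(LinearEquiv.ofInjective ι hi).trans
    (LinearEquiv.ofEq _ _ (LinearMap.exact_iff.1 he).symm)⟩

/-- Over an artinian ring: a map between projectives along which all forms extend splits. -/
theorem LExt.split [IsArtinianRing Λ] {Y P : Type u} [AddCommGroup Y] [Module Λ Y]
    [AddCommGroup P] [Module Λ P] [Module.Projective Λ Y] [Module.Projective Λ P]
    {i : Y →ₗ[Λ] P} (h : LExt i) : ∃ r : P →ₗ[Λ] Y, r ∘ₗ i = LinearMap.id := by
  let J := Ring.jacobson Λ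
  let JY : Submodule Λ Y := J • ⊤
  let JP : Submodule Λ P := J • ⊤
  have hss : ∀ (V : Type u) [AddCommGroup V] [Module Λ V],
      IsSemisimpleModule Λ (V ⧸ (J • ⊤ : Submodule Λ V)) := by
    intro V _ _
    have ht : Module.IsTorsionBySet Λ (V ⧸ (J • ⊤ : Submodule Λ V)) J := by
      rw [Module.isTorsionBySet_quotient_iff]
      exact fun m i hi ↦ Submodule.smul_mem_smul hi trivial
    let _ := ht.module
    exact (ht.semilinearMap.isSemisimpleModule_iff_of_bijective Function.bijective_id).2
      inferInstance
  have hle : JY ≤ JP.comap i := by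
    refine Submodule.smul_le.2 fun r hr y _ => ?_
    rw [Submodule.mem_comap, map_smul]
    exact Submodule.smul_mem_smul hr trivial
  let ib : (Y ⧸ JY) →ₗ[Λ] (P ⧸ JP) := JY.mapQ JP i hle
  have hform : ∀ (ψ : P →ₗ[Λ] Λ) (p : P), p ∈ JP → ψ p ∈ J := by
    intro ψ p hp
    refine Submodule.smul_induction_on hp ?_ ?_
    · intro r hr n _
      rw [map_smul, smul_eq_mul]
      exact Ideal.IsTwoSided.mul_mem_of_left _ hr
    · intro x y hx hy
      rw [map_add]; exact J.add_mem hx hy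
  obtain ⟨s, hs⟩ := (inferInstance : Module.Projective Λ Y).out
  have hib : Function.Injective ib := by
    rw [← LinearMap.ker_eq_bot, LinearMap.ker_eq_bot']
    intro y
    obtain ⟨y, rfl⟩ := Submodule.Quotient.mk_surjective _ y
    intro hy
    have hy' : i y ∈ JP := (Submodule.Quotient.mk_eq_zero _).1 hy
    rw [Submodule.Quotient.mk_eq_zero]
    have hc : ∀ c, s y c ∈ J := by
      intro c
      obtain ⟨ψ, hψ⟩ := h (Finsupp.lapply c ∘ₗ s)
      have h1 : ψ (i y) = s y c := LinearMap.congr_fun hψ y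
      rw [← h1]; exact hform ψ _ hy'
    rw [← hs y, Finsupp.linearCombination_apply]
    exact Submodule.sum_mem _ fun c _ => Submodule.smul_mem_smul (hc c) trivial
  have := hss P
  obtain ⟨ρ, hρ⟩ := IsSemisimpleModule.extension_property ib hib LinearMap.id
  obtain ⟨r, hr⟩ := Module.projective_lifting_property JY.mkQ (ρ ∘ₗ JP.mkQ)
    (Submodule.mkQ_surjective _)
  let n : Module.End Λ Y := 1 - r ∘ₗ i
  have hn1 : ∀ y, n y ∈ JY := by
    intro y
    have h1 : JY.mkQ (r (i y)) = ρ (JP.mkQ (i y)) := LinearMap.congr_fun hr (i y)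
    have h2 : ρ (ib (JY.mkQ y)) = JY.mkQ y := LinearMap.congr_fun hρ _
    have h3 : ib (JY.mkQ y) = JP.mkQ (i y) := rfl
    rw [← h3, h2] at h1
    rw [← Submodule.ker_mkQ JY, LinearMap.mem_ker]
    change JY.mkQ (y - r (i y)) = 0
    rw [map_sub, h1, sub_self]
  have hnk : ∀ k y, (n ^ k) y ∈ (J ^ k • ⊤ : Submodule Λ Y) := by
    intro k
    induction k with
    | zero =>
      intro y
      rw [Submodule.pow_zero, Ideal.one_eq_top, Submodule.top_smul]
      trivial
    | succ k ih =>
      intro y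
      rw [pow_succ', Module.End.mul_apply, Submodule.pow_succ, Submodule.mul_smul]
      refine Submodule.smul_induction_on (ih y) ?_ ?_
      · intro a ha z _
        rw [map_smul]
        exact Submodule.smul_mem_smul ha (hn1 z)
      · intro x z hx hz
        rw [map_add]; exact Submodule.add_mem _ hx hz
  have hnil : IsNilpotent n := by
    obtain ⟨k, hk⟩ := (inferInstance : IsSemiprimaryRing Λ).isNilpotent
    refine ⟨k, ?_⟩
    ext y
    have := hnk k y
    change J ^ k = 0 at hk
    rw [hk] at this
    simpa using this
  obtain ⟨v, hv⟩ := hnil.isUnit_one_sub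
  have hri : (v : Module.End Λ Y) = r ∘ₗ i := by rw [hv]; simp [n]
  refine ⟨(↑v⁻¹ : Module.End Λ Y) ∘ₗ r, ?_⟩
  rw [LinearMap.comp_assoc, ← hri]
  exact v.inv_mul

theorem gp_of_fin_class (G : ModuleCat.{u} Λ → Prop)
    (hs : ∀ X, G X → ∃ (F : ModuleCat.{u} Λ) (a : X →ₗ[Λ] F), Module.Projective Λ F ∧
      Function.Injective a ∧ LExt a ∧ G (ModuleCat.of Λ (F ⧸ LinearMap.range a)))
    (hp : ∀ X, G X → ∃ (F : ModuleCat.{u} Λ) (g : F →ₗ[Λ] X), Module.Projective Λ F ∧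
      Function.Surjective g ∧ LExt (LinearMap.ker g).subtype ∧
      G (ModuleCat.of Λ (LinearMap.ker g)))
    {M : Type u} [AddCommGroup M] [Module Λ M] (hM : G (ModuleCat.of Λ M)) :
    IsGorensteinProjective Λ M := by
  refine gp_of_class G ?_ ?_ hM
  · intro X hX
    obtain ⟨F, a, h1, h2, h3, h4⟩ := hs X hX
    refine ⟨_, h4, F, a, (LinearMap.range a).mkQ, h1, h2, Submodule.mkQ_surjective _, ?_, h3⟩
    exact LinearMap.exact_map_mkQ_range a
  · intro X hX
    obtain ⟨F, g, h1, h2, h3, h4⟩ := hp X hX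
    exact ⟨_, h4, F, (LinearMap.ker g).subtype, g, h1, Subtype.val_injective, h2,
      LinearMap.exact_subtype_ker_map g, h3⟩

theorem aux_succ [IsArtinianRing Λ] {X Y : Type u} [AddCommGroup X] [Module Λ X]
    [AddCommGroup Y] [Module Λ Y] [Module.Finite Λ X] [Module.Projective Λ Y]
    (h : IsGorensteinProjective Λ (X × Y)) :
    ∃ (F : ModuleCat.{u} Λ) (a : X →ₗ[Λ] F), Module.Finite Λ F ∧ Module.Projective Λ F ∧
      Function.Injective a ∧ LExt a ∧ ∃ Y' : ModuleCat.{u} Λ, Module.Projective Λ Y' ∧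
        IsGorensteinProjective Λ ((F ⧸ LinearMap.range a) × Y') := by
  classical
  obtain ⟨Z, hZ, P, ι, π, hP, hi, hs, he, hx⟩ := gp_succ h
  obtain ⟨r, hr⟩ := LExt.split (i := ι ∘ₗ LinearMap.inr Λ X Y) (by
    intro φ
    obtain ⟨ψ, hψ⟩ := hx (φ ∘ₗ LinearMap.snd Λ X Y)
    refine ⟨ψ, ?_⟩
    rw [← LinearMap.comp_assoc, hψ]
    ext y
    simp)
  have hr' : ∀ y, r (ι (0, y)) = y := fun y => LinearMap.congr_fun hr y
  let t : X →ₗ[Λ] Y := r ∘ₗ ι ∘ₗ LinearMap.inl Λ X Y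
  let a0 : X →ₗ[Λ] P := ι ∘ₗ (LinearMap.id.prod (-t))
  have ha0 : ∀ x, a0 x = ι (x, - t x) := fun x => rfl
  have hι : ∀ x y, r (ι (x, y)) = t x + y := by
    intro x y
    have : ((x, y) : X × Y) = (x, 0) + (0, y) := by simp
    rw [this, map_add, map_add, hr']
    rfl
  have ha0i : Function.Injective a0 := by
    intro x x' hxx
    exact congrArg Prod.fst (hi hxx)
  have ha0x : LExt a0 := by
    intro φ
    obtain ⟨ψ, hψ⟩ := hx (φ ∘ₗ LinearMap.fst Λ X Y)
    refine ⟨ψ, ?_⟩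
    ext x
    exact LinearMap.congr_fun hψ (x, - t x)
  have hsur : Function.Surjective (π.prod r) := by
    rintro ⟨z, y⟩
    obtain ⟨p, rfl⟩ := hs z
    refine ⟨p + ι (0, y - r p), Prod.ext ?_ ?_⟩
    · change π (p + ι (0, y - r p)) = π p
      rw [map_add, he.apply_apply_eq_zero, add_zero]
    · change r (p + ι (0, y - r p)) = y
      rw [map_add, hr']; abel
  have hex : Function.Exact a0 (π.prod r) := by
    intro p
    constructor
    · intro hp
      have h1 : π p = 0 := congrArg Prod.fst hp
      have h2 : r p = 0 := congrArg Prod.snd hp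
      obtain ⟨⟨x, y⟩, rfl⟩ := (he p).1 h1
      rw [hι] at h2
      exact ⟨x, by rw [ha0, eq_neg_of_add_eq_zero_right h2]⟩
    · rintro ⟨x, rfl⟩
      refine Prod.ext (he.apply_apply_eq_zero _) ?_
      change r (ι (x, - t x)) = 0
      rw [hι]; abel
  obtain ⟨s, hsec⟩ := hP.out
  obtain ⟨T, hT⟩ := (inferInstance : Module.Finite Λ X)
  let S : Finset P := T.biUnion fun x => (s (a0 x)).support
  have hS : ∀ x, (s (a0 x)).support ⊆ S := by
    intro x
    have hle : (⊤ : Submodule Λ X) ≤ (Finsupp.supported Λ Λ (S : Set P)).comap (s ∘ₗ a0) := by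
      rw [← hT, Submodule.span_le]
      intro y hy
      simp only [Submodule.comap_coe, Set.mem_preimage, SetLike.mem_coe]
      rw [Finsupp.mem_supported, Finset.coe_subset]
      exact Finset.subset_biUnion_of_mem (fun x => (s (a0 x)).support) hy
    have : s (a0 x) ∈ Finsupp.supported Λ Λ (S : Set P) := hle (x := x) trivial
    rw [Finsupp.mem_supported, Finset.coe_subset] at this
    exact this
  let F := ModuleCat.of Λ (S → Λ)
  let uu : P →ₗ[Λ] (S → Λ) := LinearMap.pi fun j => Finsupp.lapply j.1 ∘ₗ s
  let v : (S → Λ) →ₗ[Λ] P := Fintype.linearCombination Λ (fun j : S => (j : P))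
  have hv : ∀ x, v (uu (a0 x)) = a0 x := by
    intro x
    have h1 := hsec (a0 x)
    rw [Finsupp.linearCombination_apply, Finsupp.sum_of_support_subset _ (hS x) _ (by simp)] at h1
    rw [Fintype.linearCombination_apply]
    rw [← Finset.sum_coe_sort] at h1
    exact h1
  obtain ⟨e⟩ := dual_schanuel a0 (uu ∘ₗ a0) uu v (fun x => rfl) hv (π.prod r)
    (LinearMap.range (uu ∘ₗ a0)).mkQ hsur (Submodule.mkQ_surjective _) hex
    (LinearMap.exact_map_mkQ_range _)
  refine ⟨F, uu ∘ₗ a0, inferInstanceAs (Module.Finite Λ (S → Λ)),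
    inferInstanceAs (Module.Projective Λ (S → Λ)), ?_, ?_, P, hP, ?_⟩
  · intro x x' hxx
    apply ha0i
    rw [← hv x, ← hv x']
    exact congrArg v hxx
  · intro φ
    obtain ⟨ψ, hψ⟩ := ha0x φ
    refine ⟨ψ ∘ₗ v, ?_⟩
    ext x
    change ψ (v (uu (a0 x))) = φ x
    rw [hv]
    exact LinearMap.congr_fun hψ x
  · exact gp_congr e.symm (gp_prod (gp_prod hZ inferInstance)
      (inferInstanceAs (Module.Projective Λ (S → Λ))))

theorem aux_pred {X Y F : Type u} [AddCommGroup X] [Module Λ X]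
    [AddCommGroup Y] [Module Λ Y] [AddCommGroup F] [Module Λ F] [Module.Projective Λ Y]
    [Module.Projective Λ F] (h : IsGorensteinProjective Λ (X × Y)) (g : F →ₗ[Λ] X)
    (hg : Function.Surjective g) :
    LExt (LinearMap.ker g).subtype ∧ ∃ Y' : ModuleCat.{u} Λ, Module.Projective Λ Y' ∧
        IsGorensteinProjective Λ (LinearMap.ker g × Y') := by
  obtain ⟨Z, hZ, hRel⟩ := gp_pred h
  have hRel' := hRel
  obtain ⟨P, ι, π, hP, hi, hs, he, hx⟩ := hRel'
  let j : LinearMap.ker g →ₗ[Λ] F × Y := LinearMap.inl Λ F Y ∘ₗ (LinearMap.ker g).subtype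
  let G : F × Y →ₗ[Λ] X × Y := g.prodMap LinearMap.id
  have hj : Function.Injective j := LinearMap.inl_injective.comp Subtype.val_injective
  have hG : Function.Surjective G := by
    rintro ⟨x, y⟩
    obtain ⟨f, rfl⟩ := hg x
    exact ⟨(f, y), rfl⟩
  have hex : Function.Exact j G := by
    rintro ⟨f, y⟩
    constructor
    · intro h
      have h1 : g f = 0 := congrArg Prod.fst h
      have h2 : y = 0 := congrArg Prod.snd h
      exact ⟨⟨f, h1⟩, by rw [h2]; rfl⟩
    · rintro ⟨⟨k, hk⟩, h⟩
      rw [← h]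
      exact Prod.ext hk rfl
  constructor
  · intro φ
    obtain ⟨ψ, hψ⟩ := hRel.lext j G hj hG hex φ
    exact ⟨ψ ∘ₗ LinearMap.inl Λ F Y, hψ⟩
  · obtain ⟨e1⟩ := schanuel π G hs hG
    obtain ⟨e2⟩ := equiv_ker j G hj hex
    obtain ⟨e3⟩ := equiv_ker ι π hi he
    refine ⟨P, hP, ?_⟩
    have h1 : IsGorensteinProjective Λ (LinearMap.ker π × (F × Y)) :=
      gp_prod (gp_congr e3 hZ) inferInstance
    exact gp_congr (e1.trans (LinearEquiv.prodCongr e2.symm (LinearEquiv.refl _ _))) h1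

theorem gp_of_prod [IsArtinianRing Λ] {X Y : Type u} [AddCommGroup X] [Module Λ X]
    [AddCommGroup Y] [Module Λ Y] [Module.Finite Λ X] [Module.Projective Λ Y]
    (h : IsGorensteinProjective Λ (X × Y)) : IsGorensteinProjective Λ X := by
  refine gp_of_fin_class (fun X => Module.Finite Λ X ∧ ∃ Y : ModuleCat.{u} Λ,
    Module.Projective Λ Y ∧ IsGorensteinProjective Λ (X × Y)) ?_ ?_
    ⟨inferInstanceAs (Module.Finite Λ X), ModuleCat.of Λ Y,
      inferInstanceAs (Module.Projective Λ Y), h⟩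
  · rintro X ⟨hX, Y, hY, h⟩
    obtain ⟨F, a, h1, h2, h3, h4, Y', h5, h6⟩ := aux_succ h
    exact ⟨F, a, h2, h3, h4, inferInstanceAs (Module.Finite Λ (F ⧸ LinearMap.range a)), Y', h5, h6⟩
  · rintro X ⟨hX, Y, hY, h⟩
    obtain ⟨n, p, hp⟩ := Module.Finite.exists_fin' Λ X
    obtain ⟨h4, Y', h5, h6⟩ := aux_pred h p hp
    exact ⟨ModuleCat.of Λ (Fin n → Λ), p, inferInstanceAs (Module.Projective Λ (Fin n → Λ)), hp,
      h4, inferInstanceAs (Module.Finite Λ (LinearMap.ker p)), Y', h5, h6⟩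

theorem gp_fin_succ [IsArtinianRing Λ] {X : Type u} [AddCommGroup X] [Module Λ X]
    [Module.Finite Λ X] (h : IsGorensteinProjective Λ X) :
    ∃ (F : ModuleCat.{u} Λ) (a : X →ₗ[Λ] F), Module.Finite Λ F ∧ Module.Projective Λ F ∧
      Function.Injective a ∧ LExt a ∧ IsGorensteinProjective Λ (F ⧸ LinearMap.range a) := by
  obtain ⟨F, a, h1, h2, h3, h4, Y', h5, h6⟩ := aux_succ (Y := PUnit) (gp_prod h inferInstance)
  exact ⟨F, a, h1, h2, h3, h4, gp_of_prod h6⟩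

theorem gp_ker [IsArtinianRing Λ] {X F : Type u} [AddCommGroup X] [Module Λ X]
    [AddCommGroup F] [Module Λ F] [Module.Finite Λ F] [Module.Projective Λ F]
    (h : IsGorensteinProjective Λ X) (g : F →ₗ[Λ] X) (hg : Function.Surjective g) :
    LExt (LinearMap.ker g).subtype ∧ IsGorensteinProjective Λ (LinearMap.ker g) := by
  obtain ⟨h4, Y', h5, h6⟩ := aux_pred (Y := PUnit) (gp_prod h inferInstance) g hg
  exact ⟨h4, gp_of_prod h6⟩

theorem gp_coker [IsArtinianRing Λ] {X P : Type u} [AddCommGroup X] [Module Λ X]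
    [AddCommGroup P] [Module Λ P] [Module.Finite Λ X] [Module.Finite Λ P] [Module.Projective Λ P]
    (h : IsGorensteinProjective Λ X) (a : X →ₗ[Λ] P) (ha : LExt a) :
    IsGorensteinProjective Λ (P ⧸ LinearMap.range a) := by
  obtain ⟨F, b, h1, h2, h3, h4, h5⟩ := gp_fin_succ h
  obtain ⟨v, hv⟩ := h4.finite_proj a
  obtain ⟨w, hw⟩ := ha.finite_proj b
  obtain ⟨e⟩ := dual_schanuel a b w v (LinearMap.congr_fun hw) (LinearMap.congr_fun hv)
    (LinearMap.range a).mkQ (LinearMap.range b).mkQ (Submodule.mkQ_surjective _)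
    (Submodule.mkQ_surjective _) (LinearMap.exact_map_mkQ_range _) (LinearMap.exact_map_mkQ_range _)
  exact gp_of_prod (gp_congr e (gp_prod h5 inferInstance))

theorem gp_ext [IsArtinianRing Λ] {A B C : Type u} [AddCommGroup A] [Module Λ A]
    [AddCommGroup B] [Module Λ B] [AddCommGroup C] [Module Λ C] [Module.Finite Λ A]
    [Module.Finite Λ C] (hA : IsGorensteinProjective Λ A) (hC : IsGorensteinProjective Λ C)
    (f : A →ₗ[Λ] B) (g : B →ₗ[Λ] C) (hf : Function.Injective f) (hg : Function.Surjective g)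
    (he : Function.Exact f g) : IsGorensteinProjective Λ B := by
  refine gp_of_fin_class (fun B => ∃ (A C : ModuleCat.{u} Λ) (f : A →ₗ[Λ] B) (g : B →ₗ[Λ] C),
    Module.Finite Λ A ∧ Module.Finite Λ C ∧ IsGorensteinProjective Λ A ∧
    IsGorensteinProjective Λ C ∧ Function.Injective f ∧ Function.Surjective g ∧
    Function.Exact f g) ?_ ?_ ⟨ModuleCat.of Λ A, ModuleCat.of Λ C, f, g,
      inferInstanceAs (Module.Finite Λ A), inferInstanceAs (Module.Finite Λ C),
      hA, hC, hf, hg, he⟩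
  · rintro B ⟨A, C, f, g, fA, fC, hA, hC, hf, hg, he⟩
    obtain ⟨FA, a, a1, a2, a3, a4, a5⟩ := gp_fin_succ hA
    obtain ⟨FC, c, c1, c2, c3, c4, c5⟩ := gp_fin_succ hC
    obtain ⟨_, _, hRel⟩ := gp_pred hC
    obtain ⟨α, hα⟩ := (hRel.lext f g hf hg he).finite_proj a
    have hα' : ∀ x, α (f x) = a x := LinearMap.congr_fun hα
    let h : B →ₗ[Λ] FA × FC := α.prod (c ∘ₗ g)
    have hh : ∀ b, h b = (α b, c (g b)) := fun b => rfl
    refine ⟨ModuleCat.of Λ (FA × FC), h, inferInstanceAs (Module.Projective Λ (FA × FC)),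
      ?_, ?_, ?_⟩
    · rw [← LinearMap.ker_eq_bot, LinearMap.ker_eq_bot']
      intro b hb
      have h1 : α b = 0 := congrArg Prod.fst hb
      have h2 : c (g b) = 0 := congrArg Prod.snd hb
      rw [map_eq_zero_iff _ c3, he b] at h2
      obtain ⟨x, rfl⟩ := h2
      rw [hα', map_eq_zero_iff _ a3] at h1
      rw [h1, map_zero]
    · intro φ
      obtain ⟨ψA, hψA⟩ := a4 (φ ∘ₗ f)
      have hψA' : ∀ x, ψA (a x) = φ (f x) := LinearMap.congr_fun hψA
      obtain ⟨θ, hθ⟩ := factor g (φ - ψA ∘ₗ α) hg (by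
        intro b hb
        obtain ⟨x, rfl⟩ := (he b).1 hb
        simp [hα', hψA'])
      obtain ⟨ψC, hψC⟩ := c4 θ
      have hψC' : ∀ x, ψC (c x) = θ x := LinearMap.congr_fun hψC
      refine ⟨ψA.coprod ψC, ?_⟩
      ext b
      change ψA (α b) + ψC (c (g b)) = φ b
      rw [hψC', hθ, LinearMap.sub_apply, LinearMap.comp_apply]
      abel
    · refine ⟨ModuleCat.of Λ (FA ⧸ LinearMap.range a), ModuleCat.of Λ (FC ⧸ LinearMap.range c),
        (LinearMap.range a).mapQ (LinearMap.range h) (LinearMap.inl Λ FA FC) ?_,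
        (LinearMap.range h).mapQ (LinearMap.range c) (LinearMap.snd Λ FA FC) ?_,
        inferInstanceAs (Module.Finite Λ (FA ⧸ LinearMap.range a)),
        inferInstanceAs (Module.Finite Λ (FC ⧸ LinearMap.range c)), a5, c5, ?_, ?_, ?_⟩
      · rintro _ ⟨x, rfl⟩
        refine ⟨f x, ?_⟩
        rw [hh, hα', he.apply_apply_eq_zero, map_zero]
        rfl
      · rintro _ ⟨b, rfl⟩
        exact ⟨g b, rfl⟩
      · rw [← LinearMap.ker_eq_bot, LinearMap.ker_eq_bot']
        intro y hy
        obtain ⟨y, rfl⟩ := Submodule.Quotient.mk_surjective _ y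
        obtain ⟨b, hb⟩ := (Submodule.Quotient.mk_eq_zero _).1 hy
        have h1 : α b = y := congrArg Prod.fst hb
        have h2 : c (g b) = 0 := congrArg Prod.snd hb
        rw [map_eq_zero_iff _ c3, he b] at h2
        obtain ⟨x, rfl⟩ := h2
        refine (Submodule.Quotient.mk_eq_zero _).2 ⟨x, ?_⟩
        rw [← h1, hα']
      · intro y
        obtain ⟨y, rfl⟩ := Submodule.Quotient.mk_surjective _ y
        exact ⟨Submodule.Quotient.mk (0, y), rfl⟩
      · intro z
        obtain ⟨⟨x, y⟩, rfl⟩ := Submodule.Quotient.mk_surjective _ z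
        constructor
        · intro hz
          obtain ⟨w, hw⟩ := (Submodule.Quotient.mk_eq_zero _).1 hz
          change c w = y at hw
          obtain ⟨b, rfl⟩ := hg w
          refine ⟨Submodule.Quotient.mk (x - α b), ?_⟩
          refine (Submodule.Quotient.eq _).2 ⟨-b, ?_⟩
          rw [hh]
          refine Prod.ext ?_ ?_
          · change α (-b) = (x - α b) - x
            rw [map_neg]; abel
          · change c (g (-b)) = 0 - y
            rw [map_neg, map_neg, hw]; abel
        · rintro ⟨w, hw⟩
          obtain ⟨w, rfl⟩ := Submodule.Quotient.mk_surjective _ w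
          rw [← hw]
          exact (Submodule.Quotient.mk_eq_zero _).2 (Submodule.zero_mem _)
  · rintro B ⟨A, C, f, g, fA, fC, hA, hC, hf, hg, he⟩
    obtain ⟨n, p, hp⟩ := Module.Finite.exists_fin' Λ A
    obtain ⟨m, q, hq⟩ := Module.Finite.exists_fin' Λ C
    obtain ⟨p1, p2⟩ := gp_ker hA p hp
    obtain ⟨q1, q2⟩ := gp_ker hC q hq
    obtain ⟨l, hl⟩ := Module.projective_lifting_property g q hg
    have hl' : ∀ x, g (l x) = q x := LinearMap.congr_fun hl
    let h : (Fin n → Λ) × (Fin m → Λ) →ₗ[Λ] B := (f ∘ₗ p).coprod l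
    have hh : ∀ x y, h (x, y) = f (p x) + l y := fun x y => by simp [h]
    have hgh : ∀ x y, g (h (x, y)) = q y := fun x y => by
      rw [hh, map_add, he.apply_apply_eq_zero, zero_add, hl']
    let α : LinearMap.ker p →ₗ[Λ] LinearMap.ker h :=
      (LinearMap.inl Λ (Fin n → Λ) (Fin m → Λ) ∘ₗ (LinearMap.ker p).subtype).codRestrict _ (by
        rintro ⟨x, hx⟩
        have hx : p x = 0 := hx
        change h (x, 0) = 0
        rw [hh, hx, map_zero, map_zero, add_zero])
    let β : LinearMap.ker h →ₗ[Λ] LinearMap.ker q :=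
      (LinearMap.snd Λ (Fin n → Λ) (Fin m → Λ) ∘ₗ (LinearMap.ker h).subtype).codRestrict _ (by
        rintro ⟨⟨x, y⟩, hx⟩
        have hx : h (x, y) = 0 := hx
        change q y = 0
        rw [← hgh x y, hx, map_zero])
    have hα : Function.Injective α := by
      intro x x' hxx
      exact Subtype.ext (congrArg (fun t => t.1.1) hxx)
    have hβ : Function.Surjective β := by
      rintro ⟨y, hy⟩
      have hy : q y = 0 := hy
      have h1 : g (l y) = 0 := by rw [hl', hy]
      obtain ⟨a, ha⟩ := (he _).1 h1
      obtain ⟨x, rfl⟩ := hp a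
      refine ⟨⟨(-x, y), ?_⟩, rfl⟩
      rw [LinearMap.mem_ker, hh, ← ha, map_neg, map_neg, neg_add_cancel]
    have hαβ : Function.Exact α β := by
      rintro ⟨⟨x, y⟩, hxy⟩
      constructor
      · intro h0
        have h1 : y = 0 := congrArg Subtype.val h0
        subst h1
        rw [LinearMap.mem_ker, hh, map_zero, add_zero, map_eq_zero_iff _ hf] at hxy
        exact ⟨⟨x, hxy⟩, rfl⟩
      · rintro ⟨w, hw⟩
        rw [← hw]
        rfl
    refine ⟨ModuleCat.of Λ ((Fin n → Λ) × (Fin m → Λ)), h,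
      inferInstanceAs (Module.Projective Λ ((Fin n → Λ) × (Fin m → Λ))), ?_, ?_, ?_⟩
    · intro b
      obtain ⟨y, hy⟩ := hq (g b)
      have h1 : g (b - l y) = 0 := by rw [map_sub, hl', hy, sub_self]
      obtain ⟨a, ha⟩ := (he _).1 h1
      obtain ⟨x, rfl⟩ := hp a
      refine ⟨(x, y), ?_⟩
      rw [hh, ha]; abel
    · intro φ
      obtain ⟨ψA, hψA⟩ := p1 (φ ∘ₗ α)
      have hψA' : ∀ x : LinearMap.ker p, ψA x = φ (α x) := LinearMap.congr_fun hψA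
      obtain ⟨θ, hθ⟩ := factor β (φ - ψA ∘ₗ LinearMap.fst Λ (Fin n → Λ) (Fin m → Λ) ∘ₗ
        (LinearMap.ker h).subtype) hβ (by
        intro b hb
        obtain ⟨x, rfl⟩ := (hαβ b).1 hb
        have : ψA (α x).1.1 = φ (α x) := hψA' x
        simp [this])
      obtain ⟨ψC, hψC⟩ := q1 θ
      have hψC' : ∀ x : LinearMap.ker q, ψC x = θ x := LinearMap.congr_fun hψC
      refine ⟨ψA.coprod ψC, ?_⟩
      refine LinearMap.ext fun b => ?_
      have h2 : ψC b.1.2 = φ b - ψA b.1.1 := (hψC' (β b)).trans (hθ b)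
      change ψA b.1.1 + ψC b.1.2 = φ b
      rw [h2]
      abel
    · exact ⟨ModuleCat.of Λ (LinearMap.ker p), ModuleCat.of Λ (LinearMap.ker q), α, β,
        inferInstanceAs (Module.Finite Λ (LinearMap.ker p)),
        inferInstanceAs (Module.Finite Λ (LinearMap.ker q)), p2, q2, hα, hβ, hαβ⟩

theorem gp_ker_epi [IsArtinianRing Λ] {M L : Type u} [AddCommGroup M] [Module Λ M]
    [AddCommGroup L] [Module Λ L] [Module.Finite Λ M]
    (hM : IsGorensteinProjective Λ M) (hL : IsGorensteinProjective Λ L)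
    (g : M →ₗ[Λ] L) (hg : Function.Surjective g) :
    IsGorensteinProjective Λ (LinearMap.ker g) := by
  have : Module.Finite Λ L := Module.Finite.of_surjective g hg
  obtain ⟨n, p, hp⟩ := Module.Finite.exists_fin' Λ L
  obtain ⟨p1, p2⟩ := gp_ker hL p hp
  obtain ⟨l, hl⟩ := Module.projective_lifting_property g p hg
  have hl' : ∀ x, g (l x) = p x := LinearMap.congr_fun hl
  let a : LinearMap.ker p →ₗ[Λ] LinearMap.ker g × (Fin n → Λ) :=
    ((-(l ∘ₗ (LinearMap.ker p).subtype)).codRestrict _ (by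
      rintro ⟨x, hx⟩
      have hx : p x = 0 := hx
      change g (-(l x)) = 0
      rw [map_neg, hl', hx, neg_zero])).prod (LinearMap.ker p).subtype
  let b : LinearMap.ker g × (Fin n → Λ) →ₗ[Λ] M := (LinearMap.ker g).subtype.coprod l
  have hb : ∀ k x, b (k, x) = k + l x := fun k x => by simp [b]
  have : IsGorensteinProjective Λ (LinearMap.ker g × (Fin n → Λ)) := by
    refine gp_ext p2 hM a b ?_ ?_ ?_
    · intro x y hxy
      exact Subtype.ext (congrArg Prod.snd hxy)
    · intro m
      obtain ⟨x, hx⟩ := hp (g m)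
      refine ⟨(⟨m - l x, ?_⟩, x), ?_⟩
      · rw [LinearMap.mem_ker, map_sub, hl', hx, sub_self]
      · rw [hb]; change m - l x + l x = m; abel
    · rintro ⟨⟨k, hk⟩, x⟩
      have hk' : g k = 0 := hk
      rw [hb]
      constructor
      · intro h
        change k + l x = 0 at h
        have h1 : p x = 0 := by
          rw [← hl', eq_neg_of_add_eq_zero_right h, map_neg, hk', neg_zero]
        refine ⟨⟨x, h1⟩, Prod.ext (Subtype.ext ?_) rfl⟩
        change -(l x) = k
        rw [eq_neg_of_add_eq_zero_left h]
      · rintro ⟨w, hw⟩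
        have h1 : w.1 = x := congrArg Prod.snd hw
        have h2 : -(l w.1) = k := congrArg (fun t => t.1.1) hw
        rw [h1] at h2
        change k + l x = 0
        rw [← h2]; abel
  exact gp_of_prod this

theorem gp_summand [IsArtinianRing Λ] {X Y : Type u} [AddCommGroup X] [Module Λ X]
    [AddCommGroup Y] [Module Λ Y] [Module.Finite Λ X] [Module.Finite Λ Y]
    (h : IsGorensteinProjective Λ (X × Y)) : IsGorensteinProjective Λ X := by
  refine gp_of_fin_class (fun X => Module.Finite Λ X ∧ ∃ Y : ModuleCat.{u} Λ,
    Module.Finite Λ Y ∧ IsGorensteinProjective Λ (X × Y)) ?_ ?_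
    ⟨inferInstanceAs (Module.Finite Λ X), ModuleCat.of Λ Y,
      inferInstanceAs (Module.Finite Λ Y), h⟩
  · rintro X ⟨hX, Y, hY, h⟩
    obtain ⟨F, a, h1, h2, h3, h4, h5⟩ := gp_fin_succ h
    let a1 := a ∘ₗ LinearMap.inl Λ X Y
    let a2 := a ∘ₗ LinearMap.inr Λ X Y
    have x1 : LExt a1 := by
      intro φ
      obtain ⟨ψ, hψ⟩ := h4 (φ ∘ₗ LinearMap.fst Λ X Y)
      exact ⟨ψ, LinearMap.ext fun x => LinearMap.congr_fun hψ (x, 0)⟩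
    have x2 : LExt a2 := by
      intro φ
      obtain ⟨ψ, hψ⟩ := h4 (φ ∘ₗ LinearMap.snd Λ X Y)
      exact ⟨ψ, LinearMap.ext fun x => LinearMap.congr_fun hψ (0, x)⟩
    have x3 : LExt (a1.prodMap a2) := by
      intro φ
      obtain ⟨ψ1, hψ1⟩ := x1 (φ ∘ₗ LinearMap.inl Λ X Y)
      obtain ⟨ψ2, hψ2⟩ := x2 (φ ∘ₗ LinearMap.inr Λ X Y)
      refine ⟨ψ1.coprod ψ2, LinearMap.ext ?_⟩
      rintro ⟨x, y⟩
      have e1 : ψ1 (a1 x) = φ (x, 0) := LinearMap.congr_fun hψ1 x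
      have e2 : ψ2 (a2 y) = φ (0, y) := LinearMap.congr_fun hψ2 y
      change ψ1 (a1 x) + ψ2 (a2 y) = φ (x, y)
      rw [e1, e2, ← map_add]
      simp
    have hc := gp_coker h (a1.prodMap a2) x3
    obtain ⟨e⟩ := equiv_of_ker_eq (LinearMap.range (a1.prodMap a2)).mkQ
      ((LinearMap.range a1).mkQ.prodMap (LinearMap.range a2).mkQ) (Submodule.mkQ_surjective _)
      (Function.Surjective.prodMap (Submodule.mkQ_surjective _) (Submodule.mkQ_surjective _)) (by
        rw [Submodule.ker_mkQ, LinearMap.ker_prodMap, Submodule.ker_mkQ, Submodule.ker_mkQ,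
          LinearMap.range_prodMap])
    refine ⟨F, a1, h2, h3.comp LinearMap.inl_injective, x1,
      inferInstanceAs (Module.Finite Λ (F ⧸ LinearMap.range a1)),
      ModuleCat.of Λ (F ⧸ LinearMap.range a2),
      inferInstanceAs (Module.Finite Λ (F ⧸ LinearMap.range a2)), gp_congr e hc⟩
  · rintro X ⟨hX, Y, hY, h⟩
    obtain ⟨n, p, hp⟩ := Module.Finite.exists_fin' Λ X
    obtain ⟨m, q, hq⟩ := Module.Finite.exists_fin' Λ Y
    obtain ⟨k1, k2⟩ := gp_ker h (p.prodMap q) (hp.prodMap hq)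
    let i : (LinearMap.ker p × LinearMap.ker q) →ₗ[Λ] (Fin n → Λ) × (Fin m → Λ) :=
      (LinearMap.ker p).subtype.prodMap (LinearMap.ker q).subtype
    have hi : Function.Injective i :=
      Function.Injective.prodMap Subtype.val_injective Subtype.val_injective
    have hie : Function.Exact i (p.prodMap q) := by
      rw [LinearMap.exact_iff]
      simp only [i]
      rw [LinearMap.ker_prodMap, LinearMap.range_prodMap, Submodule.range_subtype,
        Submodule.range_subtype]
    obtain ⟨e⟩ := equiv_ker i (p.prodMap q) hi hie
    obtain ⟨_, _, hRel⟩ := gp_pred h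
    refine ⟨ModuleCat.of Λ (Fin n → Λ), p, inferInstanceAs (Module.Projective Λ (Fin n → Λ)), hp,
      ?_, inferInstanceAs (Module.Finite Λ (LinearMap.ker p)), ModuleCat.of Λ (LinearMap.ker q),
      inferInstanceAs (Module.Finite Λ (LinearMap.ker q)), gp_congr e.symm k2⟩
    intro φ
    obtain ⟨ψ, hψ⟩ := hRel.lext i (p.prodMap q) hi (hp.prodMap hq) hie
      (φ ∘ₗ LinearMap.fst Λ _ _)
    exact ⟨ψ ∘ₗ LinearMap.inl Λ _ _, LinearMap.ext fun x => LinearMap.congr_fun hψ (x, 0)⟩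


theorem finite_of_hasLength {M : Type u} [AddCommGroup M] [Module Λ M]
    (h : ∃ n, HasLength Λ M n) : Module.Finite Λ M := by
  obtain ⟨n, c, h0, h1, h2⟩ := h
  have hF : IsFiniteLength Λ M := isFiniteLength_of_exists_compositionSeries
    ⟨⟨n, c, h2⟩, h0, h1⟩
  obtain ⟨_, _⟩ := isFiniteLength_iff_isNoetherian_isArtinian.mp hF
  infer_instance

theorem hasLength_of_finite [IsArtinianRing Λ] {M : Type u} [AddCommGroup M] [Module Λ M]
    [Module.Finite Λ M] : ∃ n, HasLength Λ M n := by
  obtain ⟨s, h0, h1⟩ := exists_compositionSeries_of_isNoetherian_isArtinian Λ M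
  exact ⟨s.length, s.toFun, h0, h1, s.step⟩

theorem uniserial_or_dec [IsArtinianRing Λ] [IsNakayama Λ] {M : Type u} [AddCommGroup M]
    [Module Λ M] [Module.Finite Λ M] : IsUniserialMod Λ M ∨
      ∃ A B : Submodule Λ M, IsCompl A B ∧ A ≠ ⊥ ∧ B ≠ ⊥ := by
  by_cases hn : Nontrivial M
  · by_cases hd : ∃ A B : Submodule Λ M, IsCompl A B ∧ A ≠ ⊥ ∧ B ≠ ⊥
    · exact Or.inr hd
    · left
      refine IsNakayama.serial M hasLength_of_finite ⟨hn, fun N N' h => ?_⟩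
      by_contra! hc
      exact hd ⟨N, N', h, hc.1, hc.2⟩
  · left
    rw [not_nontrivial_iff_subsingleton] at hn
    intro N N'
    left
    intro x _
    rw [Subsingleton.elim x 0]
    exact N'.zero_mem

theorem dec_ind [IsArtinianRing Λ] [IsNakayama Λ]
    (C : ∀ (M : Type u) [AddCommGroup M] [Module Λ M], Prop)
    (uni : ∀ (M : Type u) [AddCommGroup M] [Module Λ M], Module.Finite Λ M →
      IsUniserialMod Λ M → C M)
    (dec : ∀ (M A B : Type u) [AddCommGroup M] [Module Λ M] [AddCommGroup A] [Module Λ A]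
      [AddCommGroup B] [Module Λ B], (M ≃ₗ[Λ] A × B) → C A → C B → C M)
    (M : Type u) [AddCommGroup M] [Module Λ M] [hM : Module.Finite Λ M] : C M := by
  induction hn : Module.length Λ M using WellFoundedLT.induction generalizing M with
  | ind n ih =>
    rcases uniserial_or_dec (Λ := Λ) (M := M) with h | ⟨A, B, hc, hA, hB⟩
    · exact uni M hM h
    · have hA' : A ≠ ⊤ := fun h => hB (by
        have := hc.disjoint.eq_bot; rwa [h, top_inf_eq] at this)
      have hB' : B ≠ ⊤ := fun h => hA (by
        have := hc.disjoint.eq_bot; rwa [h, inf_top_eq] at this)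
      exact dec M A B (Submodule.prodEquivOfIsCompl A B hc).symm
        (ih _ (hn ▸ Submodule.length_lt hA') A rfl) (ih _ (hn ▸ Submodule.length_lt hB') B rfl)

theorem uni_of_surj {M N : Type u} [AddCommGroup M] [Module Λ M] [AddCommGroup N] [Module Λ N]
    (h : IsUniserialMod Λ M) (f : M →ₗ[Λ] N) (hf : Function.Surjective f) :
    IsUniserialMod Λ N := by
  intro A B
  rcases h (A.comap f) (B.comap f) with h | h
  · exact Or.inl ((Submodule.comap_le_comap_iff_of_surjective hf).mp h)
  · exact Or.inr ((Submodule.comap_le_comap_iff_of_surjective hf).mp h)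

/-- In a uniserial module, one of two maps with jointly trivial kernels is injective. -/
theorem uni_inj {Q A B : Type u} [AddCommGroup Q] [Module Λ Q] [AddCommGroup A] [Module Λ A]
    [AddCommGroup B] [Module Λ B] (h : IsUniserialMod Λ Q) (f : Q →ₗ[Λ] A) (g : Q →ₗ[Λ] B)
    (hfg : ∀ x, f x = 0 → g x = 0 → x = 0) : Function.Injective f ∨ Function.Injective g := by
  rcases h (LinearMap.ker f) (LinearMap.ker g) with h | h
  · left
    rw [injective_iff_map_eq_zero]
    exact fun x hx => hfg x hx (h hx)
  · right
    rw [injective_iff_map_eq_zero]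
    exact fun x hx => hfg x (h hx) hx

theorem uni_emb [IsArtinianRing Λ] [IsNakayama Λ] (M : Type u) [AddCommGroup M] [Module Λ M]
    [Module.Finite Λ M] {Q : Type u} [AddCommGroup Q] [Module Λ Q] (hQ : IsUniserialMod Λ Q)
    (i : Q →ₗ[Λ] M) (hi : Function.Injective i) :
    ∃ (U : ModuleCat.{u} Λ) (f : M →ₗ[Λ] U), Module.Finite Λ U ∧ IsUniserialMod Λ U ∧
      Function.Injective (f ∘ₗ i) := by
  refine dec_ind (Λ := Λ) (fun M _ _ => ∀ i : Q →ₗ[Λ] M, Function.Injective i →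
    ∃ (U : ModuleCat.{u} Λ) (f : M →ₗ[Λ] U), Module.Finite Λ U ∧ IsUniserialMod Λ U ∧
      Function.Injective (f ∘ₗ i)) ?_ ?_ M i hi
  · intro M _ _ hM hu i hi
    exact ⟨ModuleCat.of Λ M, LinearMap.id, hM, hu, hi⟩
  · intro M A B _ _ _ _ _ _ e hA hB i hi
    rcases uni_inj hQ (LinearMap.fst Λ A B ∘ₗ e.toLinearMap ∘ₗ i)
      (LinearMap.snd Λ A B ∘ₗ e.toLinearMap ∘ₗ i) (fun x h1 h2 => hi (e.injective (by
        rw [map_zero, map_zero]; exact Prod.ext h1 h2))) with h | h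
    · obtain ⟨U, f, h1, h2, h3⟩ := hA _ h
      exact ⟨U, f ∘ₗ LinearMap.fst Λ A B ∘ₗ e.toLinearMap, h1, h2, h3⟩
    · obtain ⟨U, f, h1, h2, h3⟩ := hB _ h
      exact ⟨U, f ∘ₗ LinearMap.snd Λ A B ∘ₗ e.toLinearMap, h1, h2, h3⟩

theorem uni_cover [IsArtinianRing Λ] [IsNakayama Λ] (P : Type u) [AddCommGroup P] [Module Λ P]
    [Module.Finite Λ P] [hP : Module.Projective Λ P] {U : Type u} [AddCommGroup U] [Module Λ U]
    (hU : IsUniserialMod Λ U) (p : P →ₗ[Λ] U) (hp : Function.Surjective p) :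
    ∃ (W : ModuleCat.{u} Λ) (f : W →ₗ[Λ] U), Module.Projective Λ W ∧ IsUniserialMod Λ W ∧
      Function.Surjective f := by
  refine dec_ind (Λ := Λ) (fun P _ _ => Module.Projective Λ P → ∀ p : P →ₗ[Λ] U,
    Function.Surjective p → ∃ (W : ModuleCat.{u} Λ) (f : W →ₗ[Λ] U), Module.Projective Λ W ∧
      IsUniserialMod Λ W ∧ Function.Surjective f) ?_ ?_ P hP p hp
  · intro M _ _ hM hu hP p hp
    exact ⟨ModuleCat.of Λ M, p, hP, hu, hp⟩
  · intro M A B _ _ _ _ _ _ e hA hB hM p hp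
    have hAB : Module.Projective Λ (A × B) := Module.Projective.of_equiv e
    have hpA : Module.Projective Λ A := Module.Projective.of_split
      (LinearMap.inl Λ A B) (LinearMap.fst Λ A B) (by ext; simp)
    have hpB : Module.Projective Λ B := Module.Projective.of_split
      (LinearMap.inr Λ A B) (LinearMap.snd Λ A B) (by ext; simp)
    let fA := p ∘ₗ e.symm.toLinearMap ∘ₗ LinearMap.inl Λ A B
    let fB := p ∘ₗ e.symm.toLinearMap ∘ₗ LinearMap.inr Λ A B
    have hsum : ∀ y, ∃ a b, y = fA a + fB b := by
      intro y
      obtain ⟨x, rfl⟩ := hp y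
      refine ⟨(e x).1, (e x).2, ?_⟩
      simp only [fA, fB, LinearMap.comp_apply, ← map_add]
      congr 1
      rw [← e.symm_apply_apply x]
      simp
    rcases hU (LinearMap.range fA) (LinearMap.range fB) with h | h
    · refine hB hpB fB fun y => ?_
      obtain ⟨a, b, rfl⟩ := hsum y
      exact (LinearMap.range fB).add_mem (h ⟨a, rfl⟩) ⟨b, rfl⟩
    · refine hA hpA fA fun y => ?_
      obtain ⟨a, b, rfl⟩ := hsum y
      exact (LinearMap.range fA).add_mem ⟨a, rfl⟩ (h ⟨b, rfl⟩)

/-- A uniserial module containing a nonzero projective submodule is projective. -/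
theorem uni_proj [IsArtinianRing Λ] [IsNakayama Λ] {U Q : Type u} [AddCommGroup U] [Module Λ U]
    [Module.Finite Λ U] (hU : IsUniserialMod Λ U) [AddCommGroup Q] [Module Λ Q]
    [Module.Projective Λ Q] [Nontrivial Q] (j : Q →ₗ[Λ] U) (hj : Function.Injective j) :
    Module.Projective Λ U := by
  obtain ⟨n, p, hp⟩ := Module.Finite.exists_fin' Λ U
  obtain ⟨W, f, hW, hWu, hf⟩ := uni_cover (Fin n → Λ) hU p hp
  obtain ⟨s, hs⟩ := Module.projective_lifting_property f j hf
  have hs' : ∀ x, f (s x) = j x := fun x => LinearMap.congr_fun hs x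
  have hk : LinearMap.ker f = ⊥ := by
    rcases hWu (LinearMap.ker f) (LinearMap.range s) with h | h
    · rw [eq_bot_iff]
      intro x hx
      obtain ⟨q, rfl⟩ := h hx
      have : j q = 0 := by rw [← hs']; exact hx
      rw [hj (this.trans (map_zero j).symm)]
      simp
    · exfalso
      obtain ⟨q, hq⟩ := exists_ne (0 : Q)
      apply hq
      apply hj
      rw [← hs', map_zero]
      exact h ⟨q, rfl⟩
  exact Module.Projective.of_equiv (LinearEquiv.ofBijective f ⟨LinearMap.ker_eq_bot.mp hk, hf⟩)

theorem uni_ext [IsArtinianRing Λ] [IsNakayama Λ] {E : Type u} [AddCommGroup E] [Module Λ E]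
    [Module.Finite Λ E] (hE : IsUniserialMod Λ E) (hnp : ¬ Module.Projective Λ E)
    (N : Submodule Λ E) (P : Type u) [AddCommGroup P] [Module Λ P] [Module.Finite Λ P]
    [hP : Module.Projective Λ P] (f : N →ₗ[Λ] P) : ∃ g : E →ₗ[Λ] P, g ∘ₗ N.subtype = f := by
  refine dec_ind (Λ := Λ) (fun P _ _ => Module.Projective Λ P → ∀ f : N →ₗ[Λ] P,
    ∃ g : E →ₗ[Λ] P, g ∘ₗ N.subtype = f) ?_ ?_ P hP f
  · intro P _ _ hPf hPu hP f
    by_cases hn : Nontrivial P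
    swap
    · rw [not_nontrivial_iff_subsingleton] at hn
      exact ⟨0, LinearMap.ext fun x => Subsingleton.elim _ _⟩
    let K : Submodule Λ (E × P) := LinearMap.range (N.subtype.prod (-f))
    let iE : E →ₗ[Λ] (E × P) ⧸ K := K.mkQ ∘ₗ LinearMap.inl Λ E P
    let iP : P →ₗ[Λ] (E × P) ⧸ K := K.mkQ ∘ₗ LinearMap.inr Λ E P
    have hcomm : ∀ x : N, iE x = iP (f x) := by
      intro x
      rw [← sub_eq_zero]
      simp only [iE, iP, LinearMap.comp_apply, ← map_sub]
      rw [← LinearMap.mem_ker, Submodule.ker_mkQ]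
      exact ⟨x, by simp⟩
    have hiP : Function.Injective iP := by
      rw [injective_iff_map_eq_zero]
      intro y hy
      have : LinearMap.inr Λ E P y ∈ K := by
        rw [← Submodule.ker_mkQ K]; exact hy
      obtain ⟨x, hx⟩ := this
      have h1 : (x : E) = 0 := congrArg Prod.fst hx
      have h2 : -f x = y := congrArg Prod.snd hx
      have h3 : x = 0 := Subtype.ext h1
      rw [← h2, h3]; simp
    obtain ⟨U, k, hUf, hU, hk⟩ := uni_emb ((E × P) ⧸ K) hPu iP hiP
    rcases hU (LinearMap.range (k ∘ₗ iE)) (LinearMap.range (k ∘ₗ iP)) with h | h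
    · let e := LinearEquiv.ofInjective (k ∘ₗ iP) hk
      refine ⟨e.symm.toLinearMap ∘ₗ
        (k ∘ₗ iE).codRestrict (LinearMap.range (k ∘ₗ iP)) (fun x => h ⟨x, rfl⟩), ?_⟩
      ext x
      simp only [LinearMap.comp_apply, LinearEquiv.coe_coe]
      rw [LinearEquiv.symm_apply_eq]
      apply Subtype.ext
      exact congrArg k (hcomm x)
    · exfalso
      let I := LinearMap.range (k ∘ₗ iE)
      let r : E →ₗ[Λ] I := (k ∘ₗ iE).rangeRestrict
      have hr : Function.Surjective r := (k ∘ₗ iE).surjective_rangeRestrict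
      have hIu : IsUniserialMod Λ I := uni_of_surj hE r hr
      have hIf : Module.Finite Λ I := Module.Finite.of_surjective r hr
      let j : P →ₗ[Λ] I := (k ∘ₗ iP).codRestrict I (fun x => h ⟨x, rfl⟩)
      have hj : Function.Injective j := fun x y hxy => hk (congrArg Subtype.val hxy)
      have hIp : Module.Projective Λ I := uni_proj hIu j hj
      obtain ⟨s, hs⟩ := Module.projective_lifting_property r LinearMap.id hr
      have hs' : ∀ x, r (s x) = x := fun x => LinearMap.congr_fun hs x
      have hker : LinearMap.ker r = ⊥ := by
        rcases hE (LinearMap.ker r) (LinearMap.range s) with h | h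
        · rw [eq_bot_iff]
          intro x hx
          obtain ⟨q, rfl⟩ := h hx
          have : q = 0 := by rw [← hs' q]; exact hx
          rw [this]; simp
        · exfalso
          obtain ⟨q, hq⟩ := exists_ne (0 : P)
          apply hq
          apply hj
          rw [← hs' (j q), map_zero]
          exact h ⟨j q, rfl⟩
      exact hnp (Module.Projective.of_equiv
        (LinearEquiv.ofBijective r ⟨LinearMap.ker_eq_bot.mp hker, hr⟩).symm)
  · intro M A B _ _ _ _ _ _ e hA hB hM f
    have hAB : Module.Projective Λ (A × B) := Module.Projective.of_equiv e
    have hpA : Module.Projective Λ A := Module.Projective.of_split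
      (LinearMap.inl Λ A B) (LinearMap.fst Λ A B) (by ext; simp)
    have hpB : Module.Projective Λ B := Module.Projective.of_split
      (LinearMap.inr Λ A B) (LinearMap.snd Λ A B) (by ext; simp)
    obtain ⟨gA, hgA⟩ := hA hpA (LinearMap.fst Λ A B ∘ₗ e.toLinearMap ∘ₗ f)
    obtain ⟨gB, hgB⟩ := hB hpB (LinearMap.snd Λ A B ∘ₗ e.toLinearMap ∘ₗ f)
    refine ⟨e.symm.toLinearMap ∘ₗ gA.prod gB, ?_⟩
    ext x
    simp only [LinearMap.comp_apply, LinearEquiv.coe_coe]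
    rw [LinearEquiv.symm_apply_eq]
    exact Prod.ext (LinearMap.congr_fun hgA x) (LinearMap.congr_fun hgB x)

theorem gp_quot [IsArtinianRing Λ] [IsNakayama Λ] {E : Type u} [AddCommGroup E] [Module Λ E]
    [Module.Finite Λ E] (hE : IsUniserialMod Λ E) (hnp : ¬ Module.Projective Λ E)
    (hG : IsGorensteinProjective Λ E) (N : Submodule Λ E) (hN : IsGorensteinProjective Λ N) :
    IsGorensteinProjective Λ (E ⧸ N) := by
  obtain ⟨F, a, hFf, hFp, hai, hax, hC⟩ := gp_fin_succ hG
  let b : N →ₗ[Λ] F := a ∘ₗ N.subtype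
  have hb : LExt b := by
    intro φ
    obtain ⟨g, hg⟩ := uni_ext hE hnp N Λ φ
    obtain ⟨ψ, hψ⟩ := hax g
    exact ⟨ψ, by rw [← hg, ← hψ]; rfl⟩
  have hD := gp_coker hN b hb
  have hle : LinearMap.range b ≤ LinearMap.range a := by
    rintro _ ⟨x, rfl⟩
    exact ⟨x, rfl⟩
  let t : (F ⧸ LinearMap.range b) →ₗ[Λ] (F ⧸ LinearMap.range a) := Submodule.factor hle
  have ht : Function.Surjective t := Submodule.factor_surjective hle
  have hK := gp_ker_epi hD hC t ht
  let c : E →ₗ[Λ] LinearMap.ker t := ((LinearMap.range b).mkQ ∘ₗ a).codRestrict _ (by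
    intro x
    change t ((LinearMap.range b).mkQ (a x)) = 0
    change (LinearMap.range a).mkQ (a x) = 0
    rw [← LinearMap.mem_ker, Submodule.ker_mkQ]
    exact ⟨x, rfl⟩)
  have hc : Function.Surjective c := by
    rintro ⟨y, hy⟩
    obtain ⟨z, rfl⟩ := (LinearMap.range b).mkQ_surjective y
    have : (LinearMap.range a).mkQ z = 0 := hy
    rw [← LinearMap.mem_ker, Submodule.ker_mkQ] at this
    obtain ⟨x, rfl⟩ := this
    exact ⟨x, rfl⟩
  have hck : LinearMap.ker c = LinearMap.ker N.mkQ := by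
    rw [Submodule.ker_mkQ]
    ext x
    constructor
    · intro hx
      have h1 : (LinearMap.range b).mkQ (a x) = 0 := congrArg Subtype.val hx
      rw [← LinearMap.mem_ker, Submodule.ker_mkQ] at h1
      obtain ⟨y, hy⟩ := h1
      rw [← hai hy]
      exact y.2
    · intro hx
      apply Subtype.ext
      change (LinearMap.range b).mkQ (a x) = 0
      rw [← LinearMap.mem_ker, Submodule.ker_mkQ]
      exact ⟨⟨x, hx⟩, rfl⟩
  obtain ⟨e⟩ := equiv_of_ker_eq c N.mkQ hc N.mkQ_surjective hck
  exact gp_congr e hK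

theorem main_fwd [IsArtinianRing Λ] [IsNakayama Λ] {E : Type u} [AddCommGroup E] [Module Λ E]
    (h : IsElementary Λ E) (N : Submodule Λ E) (hb : N ≠ ⊥) (ht : N ≠ ⊤) :
    ¬ IsGorensteinProjective Λ N := by
  obtain ⟨hnt, hl, hG, hnp, hq⟩ := h
  have hf := finite_of_hasLength hl
  intro hN
  rcases uniserial_or_dec (Λ := Λ) (M := E) with hu | ⟨A, B, hc, hA, hB⟩
  · exact hq N hb ht (gp_quot hu hnp hG N hN)
  · have hA' : A ≠ ⊤ := fun h => hB (by
      have := hc.disjoint.eq_bot; rwa [h, top_inf_eq] at this)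
    have h1 : IsGorensteinProjective Λ (B × A) :=
      gp_congr (Submodule.prodEquivOfIsCompl B A hc.symm).symm hG
    exact hq A hA hA' (gp_congr (Submodule.quotientEquivOfIsCompl A B hc).symm (gp_summand h1))

theorem main_bwd [IsArtinianRing Λ] {E : Type u} [AddCommGroup E] [Module Λ E]
    [Module.Finite Λ E] (hG : IsGorensteinProjective Λ E) (N : Submodule Λ E)
    (h : IsGorensteinProjective Λ (E ⧸ N)) : IsGorensteinProjective Λ N := by
  have := gp_ker_epi hG h N.mkQ N.mkQ_surjective
  rwa [Submodule.ker_mkQ] at this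

end Machinery

end GPAux

/-- For a Nakayama algebra without simple projectives, a module `E` is elementary (nonzero
Gorenstein projective non-projective with no proper nonzero Gorenstein projective factor
module) if and only if `E` is nonzero Gorenstein projective non-projective with no proper
nonzero Gorenstein projective submodule. -/
theorem elementary_iff_no_proper_gp_submodule [IsNakayama Λ]
    (h0 : NoSimpleProjectives Λ)
    (E : Type u) [AddCommGroup E] [Module Λ E] (hfl : ∃ n, HasLength Λ E n) :
    IsElementary Λ E ↔
      Nontrivial E ∧ IsGorensteinProjective Λ E ∧ ¬ Module.Projective Λ E ∧
        ∀ N : Submodule Λ E, N ≠ ⊥ → N ≠ ⊤ → ¬ IsGorensteinProjective Λ N := by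
  haveI := IsNakayama.artinian (Λ := Λ)
  constructor
  · intro h
    exact ⟨h.1, h.2.2.1, h.2.2.2.1, fun N hb ht => GPAux.main_fwd h N hb ht⟩
  · rintro ⟨h1, h2, h3, h4⟩
    haveI := GPAux.finite_of_hasLength hfl
    exact ⟨h1, hfl, h2, h3, fun N hb ht hq => h4 N hb ht (GPAux.main_bwd h2 N hq)⟩
end

section
/- If E is an elementary Gorenstein projective module over a Nakayama algebra, there exists an elementary module E' with top E' = τ soc E and Ext¹(E, E') ≠ 0. -/
universe u

variable (Λ : Type u) [Ring Λ]

section Helpers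

variable {Λ}

/-- Every functional on `A` extends along `i : A → B`. -/
def FunctionalsExtend {A B : Type u} [AddCommGroup A] [Module Λ A] [AddCommGroup B] [Module Λ B]
    (i : A →ₗ[Λ] B) : Prop :=
  ∀ φ : A →ₗ[Λ] Λ, ∃ ψ : B →ₗ[Λ] Λ, ψ ∘ₗ i = φ

section LinAlg

variable {A B P Q M F R T K : Type u}
  [AddCommGroup A] [Module Λ A] [AddCommGroup B] [Module Λ B]
  [AddCommGroup P] [Module Λ P] [AddCommGroup Q] [Module Λ Q]
  [AddCommGroup M] [Module Λ M] [AddCommGroup F] [Module Λ F]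
  [AddCommGroup R] [Module Λ R] [AddCommGroup T] [Module Λ T]
  [AddCommGroup K] [Module Λ K]

theorem lift_exact {i : A →ₗ[Λ] P} {p : P →ₗ[Λ] M} (hi : Function.Injective i)
    (he : Function.Exact i p) (u : B →ₗ[Λ] P) (hu : p ∘ₗ u = 0) :
    ∃ v : B →ₗ[Λ] A, i ∘ₗ v = u := by
  have hr : ∀ b, u b ∈ LinearMap.range i := fun b =>
    (he (u b)).1 (LinearMap.congr_fun hu b)
  refine ⟨(LinearEquiv.ofInjective i hi).symm.toLinearMap ∘ₗ u.codRestrict _ hr, ?_⟩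
  ext b
  have := LinearEquiv.apply_symm_apply (LinearEquiv.ofInjective i hi) ⟨u b, hr b⟩
  exact congrArg Subtype.val this

theorem factor_surj {p : P →ₗ[Λ] M} (hp : Function.Surjective p) (u : P →ₗ[Λ] B)
    (hu : LinearMap.ker p ≤ LinearMap.ker u) : ∃ v : M →ₗ[Λ] B, v ∘ₗ p = u := by
  refine ⟨(LinearMap.ker p).liftQ u hu ∘ₗ
    (p.quotKerEquivOfSurjective hp).symm.toLinearMap, ?_⟩
  ext x
  have : (p.quotKerEquivOfSurjective hp).symm (p x) = Submodule.Quotient.mk x := by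
    rw [LinearEquiv.symm_apply_eq]; rfl
  simp only [LinearMap.comp_apply, LinearEquiv.coe_coe, this]
  rfl

theorem schanuel [Module.Projective Λ P] [Module.Projective Λ Q]
    {i : A →ₗ[Λ] P} {p : P →ₗ[Λ] M} {j : B →ₗ[Λ] Q} {q : Q →ₗ[Λ] M}
    (hi : Function.Injective i) (hp : Function.Surjective p) (hip : Function.Exact i p)
    (hj : Function.Injective j) (hq : Function.Surjective q) (hjq : Function.Exact j q) :
    Nonempty ((A × Q) ≃ₗ[Λ] (B × P)) := by
  obtain ⟨s, hs⟩ := Module.projective_lifting_property q p hq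
  obtain ⟨t, ht⟩ := Module.projective_lifting_property p q hp
  have hs' : ∀ x, q (s x) = p x := LinearMap.congr_fun hs
  have ht' : ∀ x, p (t x) = q x := LinearMap.congr_fun ht
  have hi0 : ∀ x, p (i x) = 0 := hip.apply_apply_eq_zero
  have hj0 : ∀ x, q (j x) = 0 := hjq.apply_apply_eq_zero
  let x1 : (A × Q) →ₗ[Λ] P := i ∘ₗ LinearMap.fst Λ A Q + t ∘ₗ LinearMap.snd Λ A Q
  let y1 : (B × P) →ₗ[Λ] Q := j ∘ₗ LinearMap.fst Λ B P + s ∘ₗ LinearMap.snd Λ B P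
  obtain ⟨b1, hb1⟩ := lift_exact hj hjq (LinearMap.snd Λ A Q - s ∘ₗ x1) (by
    ext z <;> simp [x1, hs', hi0, ht'])
  obtain ⟨a1, ha1⟩ := lift_exact hi hip (LinearMap.snd Λ B P - t ∘ₗ y1) (by
    ext z <;> simp [y1, hs', hj0, ht'])
  have hb : ∀ z, j (b1 z) = z.2 - s (x1 z) := LinearMap.congr_fun hb1
  have ha : ∀ z, i (a1 z) = z.2 - t (y1 z) := LinearMap.congr_fun ha1
  have hx : ∀ z, x1 z = i z.1 + t z.2 := fun _ => rfl
  have hy : ∀ z, y1 z = j z.1 + s z.2 := fun _ => rfl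
  refine ⟨LinearEquiv.ofLinearMap (b1.prod x1) (a1.prod y1) ?_ ?_⟩
  · refine LinearMap.ext fun z => Prod.ext (hj ?_) ?_
    · simp [hb, hx, hy, ha]
    · simp [hx, hy, ha]
  · refine LinearMap.ext fun z => Prod.ext (hi ?_) ?_
    · simp [hb, hx, hy, ha]
    · simp [hx, hy, hb]

theorem schanuel_dual
    {i : M →ₗ[Λ] P} {p : P →ₗ[Λ] A} {j : M →ₗ[Λ] Q} {q : Q →ₗ[Λ] B}
    (hp : Function.Surjective p) (hip : Function.Exact i p)
    (hq : Function.Surjective q) (hjq : Function.Exact j q)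
    (s : P →ₗ[Λ] Q) (hs : s ∘ₗ i = j) (t : Q →ₗ[Λ] P) (ht : t ∘ₗ j = i) :
    Nonempty ((A × Q) ≃ₗ[Λ] (B × P)) := by
  have hs' : ∀ x, s (i x) = j x := LinearMap.congr_fun hs
  have ht' : ∀ x, t (j x) = i x := LinearMap.congr_fun ht
  let f : (P × Q) →ₗ[Λ] (A × Q) :=
    (p ∘ₗ LinearMap.fst Λ P Q).prod (LinearMap.snd Λ P Q + s ∘ₗ LinearMap.fst Λ P Q)
  let g : (P × Q) →ₗ[Λ] (B × P) :=
    (q ∘ₗ LinearMap.snd Λ P Q).prod (LinearMap.fst Λ P Q + t ∘ₗ LinearMap.snd Λ P Q)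
  have hf : Function.Surjective f := by
    rintro ⟨a, y⟩
    obtain ⟨x, rfl⟩ := hp a
    exact ⟨(x, y - s x), by simp [f]⟩
  have hg : Function.Surjective g := by
    rintro ⟨a, y⟩
    obtain ⟨x, rfl⟩ := hq a
    exact ⟨(y - t x, x), by simp [g]⟩
  have hker : LinearMap.ker f = LinearMap.ker g := by
    ext ⟨x, y⟩
    have e1 : (x, y) ∈ LinearMap.ker f ↔ p x = 0 ∧ y + s x = 0 := Prod.mk_eq_zero
    have e2 : (x, y) ∈ LinearMap.ker g ↔ q y = 0 ∧ x + t y = 0 := Prod.mk_eq_zero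
    rw [e1, e2]
    constructor
    · rintro ⟨h1, h2⟩
      obtain ⟨m, rfl⟩ := (hip x).1 h1
      have : y = j (-m) := by rw [map_neg, ← hs']; exact eq_neg_of_add_eq_zero_left h2
      subst this
      exact ⟨hjq.apply_apply_eq_zero _, by rw [ht']; simp⟩
    · rintro ⟨h1, h2⟩
      obtain ⟨m, rfl⟩ := (hjq y).1 h1
      have : x = i (-m) := by rw [map_neg, ← ht']; exact eq_neg_of_add_eq_zero_left h2
      subst this
      exact ⟨hip.apply_apply_eq_zero _, by rw [hs']; simp⟩
  exact ⟨(f.quotKerEquivOfSurjective hf).symm.trans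
    ((Submodule.quotEquivOfEq _ _ hker).trans (g.quotKerEquivOfSurjective hg))⟩

/-- Functionals extend along `i`, hence so do maps to finitely generated projectives. -/
theorem FunctionalsExtend.extend [Module.Finite Λ F] [Module.Projective Λ F]
    {i : A →ₗ[Λ] B} (h : FunctionalsExtend i) (φ : A →ₗ[Λ] F) :
    ∃ ψ : B →ₗ[Λ] F, ψ ∘ₗ i = φ := by
  obtain ⟨n, f, g, -, -, hfg⟩ := Module.Finite.exists_comp_eq_id_of_projective Λ F
  choose ψ hψ using fun k : Fin n => h (LinearMap.proj k ∘ₗ g ∘ₗ φ)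
  refine ⟨f ∘ₗ LinearMap.pi ψ, ?_⟩
  have : LinearMap.pi ψ ∘ₗ i = g ∘ₗ φ := by
    ext a k
    exact LinearMap.congr_fun (hψ k) a
  rw [LinearMap.comp_assoc, this, ← LinearMap.comp_assoc, hfg, LinearMap.id_comp]

open Classical in
theorem fin_factor [Module.Finite Λ K] [Module.Projective Λ T] (κ : K →ₗ[Λ] T) :
    ∃ (F : ModuleCat.{u} Λ) (_ : Module.Finite Λ F) (_ : Module.Projective Λ F)
      (α : T →ₗ[Λ] F) (β : F →ₗ[Λ] T), β ∘ₗ α ∘ₗ κ = κ := by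
  obtain ⟨s, hs⟩ := Module.projective_def'.1 (‹_› : Module.Projective Λ T)
  obtain ⟨S, hS⟩ := Module.Finite.fg_top (R := Λ) (M := K)
  let J : Finset T := S.biUnion fun k => (s (κ k)).support
  let W := Finsupp.supported Λ Λ (J : Set T)
  have hW : ∀ k, s (κ k) ∈ W := by
    intro k
    have : (⊤ : Submodule Λ K) ≤ W.comap (s ∘ₗ κ) := by
      rw [← hS, Submodule.span_le]
      intro x hx
      change s (κ x) ∈ W
      rw [Finsupp.mem_supported]
      intro y hy
      exact Finset.mem_coe.2 (Finset.mem_biUnion.2 ⟨x, hx, hy⟩)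
    exact this trivial
  let e := Finsupp.supportedEquivFinsupp (M := Λ) (R := Λ) (J : Set T)
  have : Module.Finite Λ W := Module.Finite.equiv e.symm
  have : Module.Projective Λ W := Module.Projective.of_equiv e.symm
  refine ⟨ModuleCat.of Λ W, ‹_›, ‹_›, Finsupp.restrictDom Λ Λ (J : Set T) ∘ₗ s,
    Finsupp.linearCombination Λ id ∘ₗ W.subtype, ?_⟩
  ext k
  have h1 : Finsupp.restrictDom Λ Λ (J : Set T) (s (κ k)) = ⟨s (κ k), hW k⟩ :=
    LinearMap.congr_fun (Finsupp.restrictDom_comp_subtype (M := Λ) (R := Λ) (J : Set T))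
      (⟨s (κ k), hW k⟩ : W)
  simp only [LinearMap.comp_apply, h1, Submodule.subtype_apply]
  exact LinearMap.congr_fun hs (κ k)

theorem semisimple_quot [IsSemiprimaryRing Λ] :
    IsSemisimpleModule Λ (M ⧸ (Ring.jacobson Λ • (⊤ : Submodule Λ M))) := by
  have h : Module.IsTorsionBySet Λ (M ⧸ (Ring.jacobson Λ • (⊤ : Submodule Λ M)))
      (Ring.jacobson Λ) := by
    rw [Module.isTorsionBySet_quotient_iff]
    exact fun m i hi ↦ Submodule.smul_mem_smul hi trivial
  let _ := h.module
  exact (h.semilinearMap.isSemisimpleModule_iff_of_bijective Function.bijective_id).2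
      inferInstance

theorem split_of_extend [IsSemiprimaryRing Λ] [Module.Projective Λ T] [Module.Projective Λ R]
    (f : T →ₗ[Λ] R) (hf : FunctionalsExtend f) : ∃ r : R →ₗ[Λ] T, r ∘ₗ f = LinearMap.id := by
  set J := Ring.jacobson Λ with hJ
  let JT := J • (⊤ : Submodule Λ T)
  let JR := J • (⊤ : Submodule Λ R)
  have hmap : ∀ {X Y : Type u} [AddCommGroup X] [Module Λ X] [AddCommGroup Y] [Module Λ Y]
      (g : X →ₗ[Λ] Y) (x : X), x ∈ J • (⊤ : Submodule Λ X) → g x ∈ J • (⊤ : Submodule Λ Y) := by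
    intro X Y _ _ _ _ g x hx
    have := Submodule.mem_map_of_mem (f := g) hx
    rw [Submodule.map_smul''] at this
    exact Submodule.smul_mono le_rfl le_top this
  have hinj : ∀ x, f x ∈ JR → x ∈ JT := by
    intro x hx
    obtain ⟨s, hs⟩ := Module.projective_def'.1 (‹_› : Module.Projective Λ T)
    have hx' : x = (s x).sum fun t c => c • t := by
      have := LinearMap.congr_fun hs x
      simpa [Finsupp.linearCombination_apply] using this.symm
    rw [hx']
    refine Submodule.sum_mem _ fun t _ => Submodule.smul_mem_smul ?_ trivial
    obtain ⟨ψ, hψ⟩ := hf (Finsupp.lapply t ∘ₗ s)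
    have h1 : (s x) t = ψ (f x) := (LinearMap.congr_fun hψ x).symm
    have h2 := hmap ψ _ hx
    rw [h1]
    have h3 : J • (⊤ : Submodule Λ Λ) ≤ J := by
      rw [Submodule.smul_le]
      intro r hr n _
      exact Ideal.mul_mem_right _ _ hr
    exact h3 h2
  have : IsSemisimpleModule Λ (R ⧸ JR) := semisimple_quot
  let fb : (T ⧸ JT) →ₗ[Λ] (R ⧸ JR) := JT.mapQ JR f (fun x hx => hmap f x hx)
  have hfb : LinearMap.ker fb = ⊥ := by
    rw [LinearMap.ker_eq_bot']
    intro x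
    obtain ⟨x, rfl⟩ := Submodule.Quotient.mk_surjective _ x
    intro h
    have : f x ∈ JR := (Submodule.Quotient.mk_eq_zero _).1 h
    exact (Submodule.Quotient.mk_eq_zero _).2 (hinj x this)
  obtain ⟨g, hg⟩ : ∃ g : (R ⧸ JR) →ₗ[Λ] (T ⧸ JT), g ∘ₗ fb = LinearMap.id :=
    IsSemisimpleModule.extension_property fb (LinearMap.ker_eq_bot.1 hfb) LinearMap.id
  obtain ⟨r0, hr0⟩ := Module.projective_lifting_property JT.mkQ (g ∘ₗ JR.mkQ)
    (Submodule.mkQ_surjective _)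
  let n : Module.End Λ T := LinearMap.id - r0 ∘ₗ f
  have hn : ∀ x, n x ∈ JT := by
    intro x
    rw [← Submodule.Quotient.mk_eq_zero]
    have h1 : JT.mkQ (r0 (f x)) = g (JR.mkQ (f x)) := LinearMap.congr_fun hr0 (f x)
    have h2 : g (JR.mkQ (f x)) = JT.mkQ x := LinearMap.congr_fun hg (JT.mkQ x)
    change JT.mkQ (x - r0 (f x)) = 0
    rw [map_sub, h1, h2, sub_self]
  have hpow : ∀ k x, (n ^ k) x ∈ J ^ k • (⊤ : Submodule Λ T) := by
    intro k
    induction k with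
    | zero => intro x; rw [J.pow_zero, Ideal.one_eq_top, Submodule.top_smul]; trivial
    | succ k ih =>
      intro x
      rw [pow_succ', J.pow_succ, Submodule.mul_smul]
      have h1 := Submodule.mem_map_of_mem (f := n) (ih x)
      rw [Submodule.map_smul''] at h1
      refine Submodule.smul_mono le_rfl ?_ h1
      rintro _ ⟨y, -, rfl⟩
      exact hn y
  obtain ⟨k, hk⟩ := IsSemiprimaryRing.isNilpotent (R := Λ)
  have hnil : IsNilpotent n := by
    refine ⟨k, LinearMap.ext fun x => ?_⟩
    have := hpow k x
    rw [hJ, hk] at this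
    simpa using this
  have hu : IsUnit (r0 ∘ₗ f : Module.End Λ T) := by
    have h1 : (r0 ∘ₗ f : Module.End Λ T) = 1 - n := by
      simp only [n]; exact (sub_sub_cancel _ _).symm
    rw [h1]; exact hnil.isUnit_one_sub
  obtain ⟨v, hv⟩ := hu.exists_left_inv
  exact ⟨v ∘ₗ r0, hv⟩

/-- maps to a projective extend, in the needed situation -/
theorem extend_snd [IsSemiprimaryRing Λ] [Module.Projective Λ T] [Module.Projective Λ R]
    [Module.Finite Λ K] (a : (K × T) →ₗ[Λ] R) (ha : FunctionalsExtend a) :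
    ∃ r : R →ₗ[Λ] T, r ∘ₗ a = LinearMap.snd Λ K T := by
  obtain ⟨r0, hr0⟩ := split_of_extend (a ∘ₗ LinearMap.inr Λ K T) (fun φ => by
    obtain ⟨ψ, hψ⟩ := ha (φ ∘ₗ LinearMap.snd Λ K T)
    exact ⟨ψ, by rw [← LinearMap.comp_assoc, hψ]; ext; simp⟩)
  obtain ⟨F, _, _, α, β, hαβ⟩ := fin_factor (r0 ∘ₗ a ∘ₗ LinearMap.inl Λ K T)
  obtain ⟨ρ, hρ⟩ := ha.extend (F := F) (α ∘ₗ LinearMap.snd Λ K T)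
  refine ⟨β ∘ₗ ρ + (LinearMap.id - β ∘ₗ α) ∘ₗ r0, ?_⟩
  have h1 : ∀ t, r0 (a (0, t)) = t := LinearMap.congr_fun hr0
  have h2 : ∀ k, β (α (r0 (a (k, 0)))) = r0 (a (k, 0)) := LinearMap.congr_fun hαβ
  have h3 : ∀ z, ρ (a z) = α z.2 := LinearMap.congr_fun hρ
  ext z
  · simp [h2, h3]
  · simp [h1, h3]

end LinAlg
/-- `0 → A → P → B → 0` exact with `P` projective, functionals on `A` extending to `P`. -/
def GStep (A B : Type u) [AddCommGroup A] [Module Λ A] [AddCommGroup B] [Module Λ B] : Prop :=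
  ∃ (P : ModuleCat.{u} Λ) (i : A →ₗ[Λ] P) (p : P →ₗ[Λ] B), Module.Projective Λ P ∧
    Function.Injective i ∧ Function.Surjective p ∧ Function.Exact i p ∧ FunctionalsExtend i

theorem GStep.congr {A B A' B' : Type u} [AddCommGroup A] [Module Λ A] [AddCommGroup B]
    [Module Λ B] [AddCommGroup A'] [Module Λ A'] [AddCommGroup B'] [Module Λ B']
    (h : GStep (Λ := Λ) A B) (e : A ≃ₗ[Λ] A') (f : B ≃ₗ[Λ] B') : GStep (Λ := Λ) A' B' := by
  obtain ⟨P, i, p, hP, hi, hp, hip, hx⟩ := h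
  refine ⟨P, i ∘ₗ e.symm.toLinearMap, f.toLinearMap ∘ₗ p, hP, hi.comp e.symm.injective,
    f.surjective.comp hp, ?_, ?_⟩
  · intro x
    constructor
    · intro h
      have h' : p x = 0 := by simpa using h
      obtain ⟨a, rfl⟩ := (hip x).1 h'
      exact ⟨e a, by simp⟩
    · rintro ⟨a, rfl⟩
      simp [hip.apply_apply_eq_zero]
  · intro φ
    obtain ⟨ψ, hψ⟩ := hx (φ ∘ₗ e.toLinearMap)
    refine ⟨ψ, LinearMap.ext fun a => ?_⟩
    simpa using LinearMap.congr_fun hψ (e.symm a)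

/-- If one projective presentation has the extension property, all have. -/
theorem GStep.extend_of {A B K P : Type u} [AddCommGroup A] [Module Λ A] [AddCommGroup B]
    [Module Λ B] [AddCommGroup K] [Module Λ K] [AddCommGroup P] [Module Λ P]
    [Module.Projective Λ P] (h : GStep (Λ := Λ) A B) {j : K →ₗ[Λ] P} {q : P →ₗ[Λ] B}
    (hj : Function.Injective j) (hq : Function.Surjective q) (hjq : Function.Exact j q) :
    FunctionalsExtend j := by
  obtain ⟨R, i, p, hR, hi, hp, hip, hx⟩ := h
  intro φ
  obtain ⟨f, hf⟩ := Module.projective_lifting_property q p hq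
  obtain ⟨g, hg⟩ := Module.projective_lifting_property p q hp
  have hf' : ∀ x, q (f x) = p x := LinearMap.congr_fun hf
  have hg' : ∀ x, p (g x) = q x := LinearMap.congr_fun hg
  have hi0 : ∀ x, p (i x) = 0 := hip.apply_apply_eq_zero
  have hj0 : ∀ x, q (j x) = 0 := hjq.apply_apply_eq_zero
  obtain ⟨f1, hf1⟩ := lift_exact hj hjq (f ∘ₗ i) (by ext x; simp [hf', hi0])
  obtain ⟨g1, hg1⟩ := lift_exact hi hip (g ∘ₗ j) (by ext x; simp [hg', hj0])
  obtain ⟨w, hw⟩ := lift_exact hj hjq (LinearMap.id - f ∘ₗ g) (by ext x; simp [hf', hg'])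
  obtain ⟨ψ, hψ⟩ := hx (φ ∘ₗ f1)
  have hf1' : ∀ x, j (f1 x) = f (i x) := LinearMap.congr_fun hf1
  have hg1' : ∀ x, i (g1 x) = g (j x) := LinearMap.congr_fun hg1
  have hw' : ∀ x, j (w x) = x - f (g x) := LinearMap.congr_fun hw
  have hψ' : ∀ x, ψ (i x) = φ (f1 x) := LinearMap.congr_fun hψ
  refine ⟨φ ∘ₗ w + ψ ∘ₗ g, LinearMap.ext fun k => ?_⟩
  have : w (j k) = k - f1 (g1 k) := hj (by rw [hw', map_sub, hf1', hg1'])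
  simp [this, ← hg1', hψ']

def LGood (M : Type u) [AddCommGroup M] [Module Λ M] : Prop :=
  ∃ C : ModuleCat.{u} Λ → Prop, C (ModuleCat.of Λ M) ∧
    ∀ N : ModuleCat.{u} Λ, C N → ∃ N' : ModuleCat.{u} Λ, C N' ∧ GStep (Λ := Λ) N' N

def RGood (M : Type u) [AddCommGroup M] [Module Λ M] : Prop :=
  ∃ C : ModuleCat.{u} Λ → Prop, C (ModuleCat.of Λ M) ∧
    ∀ N : ModuleCat.{u} Λ, C N → ∃ N' : ModuleCat.{u} Λ, C N' ∧ GStep (Λ := Λ) N N'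

theorem exists_chain {X : Type*} (C : X → Prop) (r : X → X → Prop)
    (h : ∀ x, C x → ∃ y, C y ∧ r x y) (x : X) (hx : C x) :
    ∃ s : ℕ → X, s 0 = x ∧ ∀ n, r (s n) (s (n + 1)) := by
  choose! f hf using h
  have hC : ∀ n, C (f^[n] x) := by
    intro n
    induction n with
    | zero => exact hx
    | succ n ih => rw [Function.iterate_succ_apply']; exact (hf _ ih).1
  refine ⟨fun n => f^[n] x, rfl, fun n => ?_⟩
  simp only [Function.iterate_succ_apply']
  exact (hf _ (hC n)).2

theorem gp_iff (M : Type u) [AddCommGroup M] [Module Λ M] :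
    IsGorensteinProjective Λ M ↔ LGood (Λ := Λ) M ∧ RGood (Λ := Λ) M := by
  constructor
  · rintro ⟨P, d, hP, hd, hx, ⟨e⟩⟩
    have key : ∀ i, GStep (Λ := Λ) (LinearMap.range (d (i + 1))) (LinearMap.range (d i)) := by
      intro i
      refine ⟨P (i + 1), (LinearMap.range (d (i + 1))).subtype, (d i).rangeRestrict, hP _,
        Subtype.val_injective, LinearMap.surjective_rangeRestrict _, ?_, ?_⟩
      · intro x
        have := hd i x
        constructor
        · intro h
          have h' : d i x = 0 := congrArg Subtype.val h
          exact ⟨⟨x, this.1 h'⟩, rfl⟩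
        · rintro ⟨y, rfl⟩
          exact Subtype.ext (this.2 y.2)
      · intro φ
        obtain ⟨ψ, hψ⟩ := hx (i + 1) (φ ∘ₗ (d (i + 1)).rangeRestrict) (by
          refine LinearMap.ext fun x => ?_
          have : (d (i + 1)).rangeRestrict (d (i + 1 + 1) x) = 0 :=
            Subtype.ext ((hd (i + 1)).apply_apply_eq_zero x)
          simp [this])
        refine ⟨ψ, LinearMap.ext ?_⟩
        rintro ⟨_, y, rfl⟩
        exact LinearMap.congr_fun hψ y
    refine ⟨⟨fun N => ∃ i, Nonempty (N ≃ₗ[Λ] LinearMap.range (d i)), ⟨0, ⟨e⟩⟩, ?_⟩,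
      ⟨fun N => ∃ i, Nonempty (N ≃ₗ[Λ] LinearMap.range (d i)), ⟨0, ⟨e⟩⟩, ?_⟩⟩
    · rintro N ⟨i, ⟨f⟩⟩
      exact ⟨ModuleCat.of Λ (LinearMap.range (d (i + 1))), ⟨i + 1, ⟨LinearEquiv.refl _ _⟩⟩,
        (key i).congr (LinearEquiv.refl _ _) f.symm⟩
    · rintro N ⟨i, ⟨f⟩⟩
      obtain ⟨k, rfl⟩ : ∃ k, i = k + 1 := ⟨i - 1, by ring⟩
      exact ⟨ModuleCat.of Λ (LinearMap.range (d k)), ⟨k, ⟨LinearEquiv.refl _ _⟩⟩,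
        (key k).congr f.symm (LinearEquiv.refl _ _)⟩
  · rintro ⟨⟨C, hC, hL⟩, ⟨D, hD, hR⟩⟩
    obtain ⟨l, l0, hl⟩ := exists_chain C (fun x y => GStep (Λ := Λ) y x) hL _ hC
    obtain ⟨r, r0, hr⟩ := exists_chain D (fun x y => GStep (Λ := Λ) x y) hR _ hD
    let s : ℤ → ModuleCat.{u} Λ := fun i => if 1 ≤ i then l (i - 1).toNat else r (1 - i).toNat
    have s1 : s 1 = ModuleCat.of Λ M := by simp [s, l0]
    have hs : ∀ i, GStep (Λ := Λ) (s (i + 1)) (s i) := by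
      intro i
      by_cases h : 1 ≤ i
      · have e1 : s (i + 1) = l ((i - 1).toNat + 1) := by
          simp only [s]; rw [if_pos (by omega)]; congr 1; omega
        have e2 : s i = l (i - 1).toNat := if_pos h
        rw [e1, e2]; exact hl _
      · have e2 : s i = r ((-i).toNat + 1) := by
          simp only [s]; rw [if_neg h]; congr 1; omega
        have e1 : s (i + 1) = r (-i).toNat := by
          by_cases h0 : i = 0
          · subst h0; simp [s, l0, r0]
          · simp only [s]; rw [if_neg (by omega)]; congr 1; omega
        rw [e1, e2]; exact hr _
    choose P i p hP hi hp hip hx using hs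
    refine ⟨P, fun k => i k ∘ₗ p (k + 1), hP, ?_, ?_, ?_⟩
    · intro k x
      constructor
      · intro h
        have h1 : p (k + 1) x = 0 := hi k (by simpa using h)
        obtain ⟨y, rfl⟩ := (hip (k + 1) x).1 h1
        obtain ⟨z, rfl⟩ := hp (k + 1 + 1) y
        exact ⟨z, rfl⟩
      · rintro ⟨y, rfl⟩
        simp [(hip (k + 1)).apply_apply_eq_zero]
    · intro k φ hφ
      obtain ⟨θ, hθ⟩ := factor_surj (hp (k + 1)) φ (by
        intro x hx
        obtain ⟨y, rfl⟩ := (hip (k + 1) x).1 hx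
        obtain ⟨z, rfl⟩ := hp (k + 1 + 1) y
        exact LinearMap.congr_fun hφ z)
      obtain ⟨ψ, hψ⟩ := hx k θ
      exact ⟨ψ, by rw [← LinearMap.comp_assoc, hψ, hθ]⟩
    · have h1 : LinearMap.range (i 0 ∘ₗ p (0 + 1)) = LinearMap.range (i 0) := by
        rw [LinearMap.range_comp, LinearMap.range_eq_top.2 (hp _), Submodule.map_top]
      have e : (s (0 + 1) : Type u) ≃ₗ[Λ] LinearMap.range (i 0) :=
        LinearEquiv.ofInjective (i 0) (hi 0)
      have e2 : Nonempty (M ≃ₗ[Λ] (s (0 + 1) : Type u)) := by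
        rw [zero_add, s1]; exact ⟨LinearEquiv.refl _ _⟩
      exact ⟨e2.some.trans (e.trans (LinearEquiv.ofEq _ _ h1.symm))⟩

theorem gp_congr {M N : Type u} [AddCommGroup M] [Module Λ M] [AddCommGroup N] [Module Λ N]
    (e : M ≃ₗ[Λ] N) (h : IsGorensteinProjective Λ M) : IsGorensteinProjective Λ N := by
  obtain ⟨P, d, hP, hd, hx, ⟨f⟩⟩ := h
  exact ⟨P, d, hP, hd, hx, ⟨e.symm.trans f⟩⟩

/-- The left class is closed under summands (modulo projectives). -/
theorem lgood_closure (C : ModuleCat.{u} Λ → Prop)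
    (hC : ∀ N : ModuleCat.{u} Λ, C N → ∃ N' : ModuleCat.{u} Λ, C N' ∧ GStep (Λ := Λ) N' N)
    {N N' X Q : Type u} [AddCommGroup N] [Module Λ N] [AddCommGroup N'] [Module Λ N']
    [AddCommGroup X] [Module Λ X] [AddCommGroup Q] [Module Λ Q] [Module.Projective Λ Q]
    (hX : C (ModuleCat.of Λ X)) (e : (N × N') ≃ₗ[Λ] (X × Q))
    {F : Type u} [AddCommGroup F] [Module Λ F] [Module.Projective Λ F]
    (f : F →ₗ[Λ] N) (hf : Function.Surjective f) :
    FunctionalsExtend (LinearMap.ker f).subtype ∧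
    ∃ (N1' X1 Q1 : ModuleCat.{u} Λ), C X1 ∧ Module.Projective Λ Q1 ∧
      Nonempty ((LinearMap.ker f × N1') ≃ₗ[Λ] (X1 × Q1)) := by
  obtain ⟨X1, hX1, R, i, p, hR, hi, hp, hip, hx⟩ := hC _ hX
  let F' := N' →₀ Λ
  let f' : F' →ₗ[Λ] N' := Finsupp.linearCombination Λ id
  have hf' : Function.Surjective f' := Finsupp.linearCombination_id_surjective Λ N'
  let j : (LinearMap.ker f × LinearMap.ker f') →ₗ[Λ] F × F' :=
    LinearMap.prodMap (LinearMap.ker f).subtype (LinearMap.ker f').subtype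
  let q : (F × F') →ₗ[Λ] N × N' := LinearMap.prodMap f f'
  have hj : Function.Injective j :=
    Function.Injective.prodMap Subtype.val_injective Subtype.val_injective
  have hq : Function.Surjective q := Function.Surjective.prodMap hf hf'
  have hjq : Function.Exact j q := by
    rintro ⟨x, y⟩
    constructor
    · intro h
      have h1 : f x = 0 := congrArg Prod.fst h
      have h2 : f' y = 0 := congrArg Prod.snd h
      exact ⟨(⟨x, h1⟩, ⟨y, h2⟩), rfl⟩
    · rintro ⟨⟨⟨a, ha⟩, ⟨b, hb⟩⟩, h⟩
      have h1 : a = x := congrArg Prod.fst h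
      have h2 : b = y := congrArg Prod.snd h
      subst h1 h2
      exact Prod.ext ha hb
  let i' : X1 →ₗ[Λ] R × Q := LinearMap.inl Λ R Q ∘ₗ i
  let p' : (R × Q) →ₗ[Λ] N × N' := e.symm.toLinearMap ∘ₗ LinearMap.prodMap p LinearMap.id
  have hi' : Function.Injective i' := LinearMap.inl_injective.comp hi
  have hp' : Function.Surjective p' :=
    e.symm.surjective.comp (Function.Surjective.prodMap hp Function.surjective_id)
  have hip' : Function.Exact i' p' := by
    rintro ⟨x, y⟩
    constructor
    · intro h
      have h0 : (p x, y) = (0 : X × Q) := e.symm.injective (by rw [map_zero]; exact h)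
      have h1 : p x = 0 := congrArg Prod.fst h0
      have h2 : y = 0 := congrArg Prod.snd h0
      obtain ⟨z, rfl⟩ := (hip x).1 h1
      exact ⟨z, by rw [h2]; rfl⟩
    · rintro ⟨z, h⟩
      rw [← h]
      change e.symm (p (i z), 0) = 0
      rw [hip.apply_apply_eq_zero]
      exact map_zero _
  have hx' : FunctionalsExtend i' := by
    intro φ
    obtain ⟨ψ, hψ⟩ := hx φ
    exact ⟨ψ ∘ₗ LinearMap.fst Λ R Q, hψ⟩
  have hst : GStep (Λ := Λ) X1 (N × N') :=
    ⟨ModuleCat.of Λ (R × Q), i', p', inferInstanceAs (Module.Projective Λ (R × Q)),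
      hi', hp', hip', hx'⟩
  constructor
  · intro φ
    let φ' : (LinearMap.ker f × LinearMap.ker f') →ₗ[Λ] Λ :=
      φ ∘ₗ LinearMap.fst Λ (LinearMap.ker f) (LinearMap.ker f')
    obtain ⟨ψ, hψ⟩ := hst.extend_of (K := LinearMap.ker f × LinearMap.ker f') (j := j) (q := q) hj hq hjq φ'
    refine ⟨ψ ∘ₗ LinearMap.inl Λ F F', LinearMap.ext fun x => ?_⟩
    exact LinearMap.congr_fun hψ (x, 0)
  · obtain ⟨g⟩ := schanuel (A := LinearMap.ker f × LinearMap.ker f') (i := j) (p := q) hj hq hjq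
      hi' hp' hip'
    exact ⟨ModuleCat.of Λ (LinearMap.ker f' × (R × Q)), X1, ModuleCat.of Λ (F × F'), hX1,
      inferInstanceAs (Module.Projective Λ (F × F')),
      ⟨(LinearEquiv.prodAssoc Λ _ _ _).symm.trans g⟩⟩

theorem LGood.summand {N N' X Q : Type u} [AddCommGroup N] [Module Λ N] [AddCommGroup N']
    [Module Λ N'] [AddCommGroup X] [Module Λ X] [AddCommGroup Q] [Module Λ Q]
    [Module.Projective Λ Q] (hX : LGood (Λ := Λ) X) (e : (N × N') ≃ₗ[Λ] (X × Q)) :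
    LGood (Λ := Λ) N := by
  obtain ⟨C, hC0, hC⟩ := hX
  refine ⟨fun N => ∃ (N' X Q : ModuleCat.{u} Λ), C X ∧ Module.Projective Λ Q ∧
      Nonempty ((N × N') ≃ₗ[Λ] (X × Q)),
    ⟨ModuleCat.of Λ N', ModuleCat.of Λ X, ModuleCat.of Λ Q, hC0, ‹_›, ⟨e⟩⟩, ?_⟩
  rintro N ⟨N', X, Q, hX, hQ, ⟨e⟩⟩
  have hf := Finsupp.linearCombination_id_surjective Λ N
  obtain ⟨h1, h2⟩ := lgood_closure C hC (X := X) hX e (Finsupp.linearCombination Λ id) hf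
  exact ⟨ModuleCat.of Λ (LinearMap.ker (Finsupp.linearCombination Λ (id : N → N))), h2,
    ModuleCat.of Λ (N →₀ Λ), (LinearMap.ker _).subtype, Finsupp.linearCombination Λ id,
    inferInstanceAs (Module.Projective Λ (N →₀ Λ)), Subtype.val_injective, hf,
    LinearMap.exact_subtype_ker_map _, h1⟩

/-- Syzygies of Gorenstein projectives. -/
theorem gp_syzygy {E P : Type u} [AddCommGroup E] [Module Λ E] [AddCommGroup P] [Module Λ P]
    [Module.Projective Λ P] (hE : IsGorensteinProjective Λ E) (p : P →ₗ[Λ] E)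
    (hp : Function.Surjective p) :
    FunctionalsExtend (LinearMap.ker p).subtype ∧
      IsGorensteinProjective Λ (LinearMap.ker p) := by
  rw [gp_iff] at hE
  obtain ⟨⟨C, hC0, hC⟩, ⟨D, hD0, hD⟩⟩ := hE
  obtain ⟨h1, N1', X1, Q1, hX1, hQ1, ⟨e⟩⟩ := lgood_closure C hC (X := E) (Q := PUnit.{u + 1})
    (N' := PUnit.{u + 1}) hC0 (LinearEquiv.refl _ _) p hp
  refine ⟨h1, (gp_iff _).2 ⟨LGood.summand (X := X1) ⟨C, hX1, hC⟩ e, ?_⟩⟩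
  refine ⟨fun N => D N ∨ N = ModuleCat.of Λ (LinearMap.ker p), Or.inr rfl, ?_⟩
  rintro N (hN | rfl)
  · obtain ⟨N', h, h'⟩ := hD N hN
    exact ⟨N', Or.inl h, h'⟩
  · exact ⟨ModuleCat.of Λ E, Or.inl hD0, ModuleCat.of Λ P, (LinearMap.ker p).subtype, p, ‹_›,
      Subtype.val_injective, hp, LinearMap.exact_subtype_ker_map _, h1⟩
/-- modules stably equivalent to a member of `C` -/
def KClass (C : ModuleCat.{u} Λ → Prop) (K : Type u) [AddCommGroup K] [Module Λ K] : Prop :=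
  ∃ (X Q T : ModuleCat.{u} Λ), C X ∧ Module.Projective Λ Q ∧ Module.Projective Λ T ∧
    Nonempty ((X × Q) ≃ₗ[Λ] (K × T))

theorem exact_mkQ_range {A B : Type u} [AddCommGroup A] [Module Λ A] [AddCommGroup B]
    [Module Λ B] (u : A →ₗ[Λ] B) : Function.Exact u (LinearMap.range u).mkQ := by
  intro x
  rw [Submodule.mkQ_apply, Submodule.Quotient.mk_eq_zero]
  rfl

theorem kclass_step [IsSemiprimaryRing Λ] (C : ModuleCat.{u} Λ → Prop)
    (hC : ∀ N : ModuleCat.{u} Λ, C N → ∃ N' : ModuleCat.{u} Λ, C N' ∧ GStep (Λ := Λ) N N')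
    {K : Type u} [AddCommGroup K] [Module Λ K] [Module.Finite Λ K] (hK : KClass C K) :
    ∃ (F : ModuleCat.{u} Λ) (u : K →ₗ[Λ] F), Module.Finite Λ F ∧ Module.Projective Λ F ∧
      Function.Injective u ∧ FunctionalsExtend u ∧ KClass C (F ⧸ LinearMap.range u) := by
  obtain ⟨X, Q, T, hX, hQ, hT, ⟨e⟩⟩ := hK
  obtain ⟨X1, hX1, P, i, p, hP, hi, hp, hip, hx⟩ := hC X hX
  let R := P × Q
  let a : (K × T) →ₗ[Λ] R := LinearMap.prodMap i LinearMap.id ∘ₗ e.symm.toLinearMap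
  let b : R →ₗ[Λ] X1 := p ∘ₗ LinearMap.fst Λ P Q
  have ha : Function.Injective a :=
    (Function.Injective.prodMap hi Function.injective_id).comp e.symm.injective
  have hb : Function.Surjective b := hp.comp Prod.fst_surjective
  have hab : Function.Exact a b := by
    rintro ⟨x, y⟩
    constructor
    · intro h
      obtain ⟨z, rfl⟩ := (hip x).1 h
      refine ⟨e (z, y), ?_⟩
      change LinearMap.prodMap i LinearMap.id (e.symm (e (z, y))) = (i z, y)
      rw [e.symm_apply_apply]
      rfl
    · rintro ⟨z, h⟩
      rw [← h]
      exact hip.apply_apply_eq_zero _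
  have hax : FunctionalsExtend a := by
    intro φ
    obtain ⟨ψ, hψ⟩ := hx (φ ∘ₗ e.toLinearMap ∘ₗ LinearMap.inl Λ X Q)
    refine ⟨LinearMap.coprod ψ (φ ∘ₗ e.toLinearMap ∘ₗ LinearMap.inr Λ X Q), ?_⟩
    refine LinearMap.ext fun z => ?_
    obtain ⟨⟨w, y⟩, rfl⟩ := e.surjective z
    have h1 : a (e (w, y)) = (i w, y) := by
      change LinearMap.prodMap i LinearMap.id (e.symm (e (w, y))) = (i w, y)
      rw [e.symm_apply_apply]
      rfl
    have h2 : ψ (i w) = φ (e (w, 0)) := LinearMap.congr_fun hψ w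
    change LinearMap.coprod ψ (φ ∘ₗ e.toLinearMap ∘ₗ LinearMap.inr Λ X Q) (a (e (w, y))) = _
    rw [h1, LinearMap.coprod_apply, h2]
    change φ (e (w, 0)) + φ (e (0, y)) = _
    rw [← map_add, ← map_add]
    simp
  obtain ⟨r, hr⟩ := extend_snd a hax
  let κ : K →ₗ[Λ] R := a ∘ₗ LinearMap.inl Λ K T
  obtain ⟨F, hF1, hF2, α, β, hαβ⟩ := fin_factor κ
  let v : K →ₗ[Λ] F := α ∘ₗ κ
  have hβv : ∀ k, β (v k) = a (k, 0) := LinearMap.congr_fun hαβ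
  have hv : Function.Injective v := by
    intro x y h
    have h1 : a (x, 0) = a (y, 0) := by rw [← hβv, ← hβv, h]
    exact congrArg Prod.fst (ha h1)
  have hvx : FunctionalsExtend v := by
    intro φ
    obtain ⟨ψ, hψ⟩ := hax (φ ∘ₗ LinearMap.fst Λ K T)
    refine ⟨ψ ∘ₗ β, LinearMap.ext fun k => ?_⟩
    change ψ (β (v k)) = φ k
    rw [hβv]
    exact LinearMap.congr_fun hψ (k, 0)
  refine ⟨F, v, hF1, hF2, hv, hvx, ?_⟩
  let j : (K × T) →ₗ[Λ] F × T := LinearMap.prodMap v LinearMap.id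
  let q : (F × T) →ₗ[Λ] (F ⧸ LinearMap.range v) :=
    (LinearMap.range v).mkQ ∘ₗ LinearMap.fst Λ F T
  have hq : Function.Surjective q := (Submodule.mkQ_surjective _).comp Prod.fst_surjective
  have hjq : Function.Exact j q := by
    rintro ⟨x, y⟩
    constructor
    · intro h
      obtain ⟨k, rfl⟩ := (exact_mkQ_range v x).1 h
      exact ⟨(k, y), rfl⟩
    · rintro ⟨z, h⟩
      rw [← h]
      exact (exact_mkQ_range v).apply_apply_eq_zero z.1
  obtain ⟨s1, hs1⟩ := hax.extend (v ∘ₗ LinearMap.fst Λ K T)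
  obtain ⟨g⟩ := schanuel_dual (M := K × T) (P := R) (Q := F × T) hb hab hq hjq (s1.prod r)
    (by
      refine LinearMap.ext fun z => Prod.ext ?_ ?_
      · exact LinearMap.congr_fun hs1 z
      · exact LinearMap.congr_fun hr z)
    (LinearMap.coprod β (a ∘ₗ LinearMap.inr Λ K T))
    (by
      refine LinearMap.ext fun z => ?_
      change LinearMap.coprod β (a ∘ₗ LinearMap.inr Λ K T) (v z.1, z.2) = a z
      rw [LinearMap.coprod_apply, hβv]
      change a (z.1, 0) + a (0, z.2) = a z
      rw [← map_add]
      simp)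
  exact ⟨X1, ModuleCat.of Λ (F × T), ModuleCat.of Λ R, hX1,
    inferInstanceAs (Module.Projective Λ (F × T)), inferInstanceAs (Module.Projective Λ (P × Q)),
    ⟨g⟩⟩

theorem RGood.summand [IsSemiprimaryRing Λ] {E A B : Type u} [AddCommGroup E] [Module Λ E]
    [AddCommGroup A] [Module Λ A] [AddCommGroup B] [Module Λ B] [Module.Finite Λ E]
    (hE : RGood (Λ := Λ) E) (e : E ≃ₗ[Λ] (A × B)) : RGood (Λ := Λ) A := by
  obtain ⟨C, hC0, hC⟩ := hE
  have hfA : Module.Finite Λ A := Module.Finite.of_surjective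
    (LinearMap.fst Λ A B ∘ₗ e.toLinearMap) (Prod.fst_surjective.comp e.surjective)
  have hfB : Module.Finite Λ B := Module.Finite.of_surjective
    (LinearMap.snd Λ A B ∘ₗ e.toLinearMap) (Prod.snd_surjective.comp e.surjective)
  refine ⟨fun M => Module.Finite Λ M ∧ ∃ N : ModuleCat.{u} Λ, Module.Finite Λ N ∧
    KClass C (M × N), ⟨hfA, ModuleCat.of Λ B, hfB, ModuleCat.of Λ E,
      ModuleCat.of Λ PUnit.{u + 1}, ModuleCat.of Λ PUnit.{u + 1}, hC0,
      inferInstanceAs (Module.Projective Λ PUnit.{u + 1}),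
      inferInstanceAs (Module.Projective Λ PUnit.{u + 1}),
      ⟨LinearEquiv.prodCongr e (LinearEquiv.refl _ _)⟩⟩, ?_⟩
  rintro M ⟨hM, N, hN, hMN⟩
  obtain ⟨F, v, hF1, hF2, hv, hvx, X, Q, T, hX, hQ, hT, ⟨f⟩⟩ := kclass_step C hC hMN
  let v1 : M →ₗ[Λ] F := v ∘ₗ LinearMap.inl Λ M N
  let v2 : N →ₗ[Λ] F := v ∘ₗ LinearMap.inr Λ M N
  have hv1 : Function.Injective v1 := hv.comp LinearMap.inl_injective
  have hv1x : FunctionalsExtend v1 := by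
    intro φ
    obtain ⟨ψ, hψ⟩ := hvx (φ ∘ₗ LinearMap.fst Λ M N)
    exact ⟨ψ, LinearMap.ext fun k => LinearMap.congr_fun hψ (k, 0)⟩
  have hv2x : FunctionalsExtend v2 := by
    intro φ
    obtain ⟨ψ, hψ⟩ := hvx (φ ∘ₗ LinearMap.snd Λ M N)
    exact ⟨ψ, LinearMap.ext fun k => LinearMap.congr_fun hψ (0, k)⟩
  let C1 := F ⧸ LinearMap.range v1
  let C2 := F ⧸ LinearMap.range v2
  let j : (M × N) →ₗ[Λ] F × F := LinearMap.prodMap v1 v2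
  let q : (F × F) →ₗ[Λ] C1 × C2 :=
    LinearMap.prodMap (LinearMap.range v1).mkQ (LinearMap.range v2).mkQ
  have hq : Function.Surjective q :=
    Function.Surjective.prodMap (Submodule.mkQ_surjective _) (Submodule.mkQ_surjective _)
  have hjq : Function.Exact j q := by
    rintro ⟨x, y⟩
    constructor
    · intro h
      obtain ⟨k, rfl⟩ := (exact_mkQ_range v1 x).1 (congrArg Prod.fst h)
      obtain ⟨l, rfl⟩ := (exact_mkQ_range v2 y).1 (congrArg Prod.snd h)
      exact ⟨(k, l), rfl⟩
    · rintro ⟨z, h⟩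
      rw [← h]
      exact Prod.ext ((exact_mkQ_range v1).apply_apply_eq_zero z.1)
        ((exact_mkQ_range v2).apply_apply_eq_zero z.2)
  obtain ⟨s, hs⟩ := hvx.extend (F := F × F) j
  obtain ⟨t1, ht1⟩ := hv1x.extend v1
  obtain ⟨t2, ht2⟩ := hv2x.extend v2
  obtain ⟨g⟩ := schanuel_dual (M := M × N) (P := F) (Q := F × F) (B := C1 × C2)
    (Submodule.mkQ_surjective _) (exact_mkQ_range v) hq hjq s hs (LinearMap.coprod t1 t2)
    (by
      refine LinearMap.ext fun z => ?_
      change LinearMap.coprod t1 t2 (v1 z.1, v2 z.2) = v z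
      have h1 : t1 (v1 z.1) = v (z.1, 0) := LinearMap.congr_fun ht1 z.1
      have h2 : t2 (v2 z.2) = v (0, z.2) := LinearMap.congr_fun ht2 z.2
      rw [LinearMap.coprod_apply, h1, h2, ← map_add]
      simp)
  refine ⟨ModuleCat.of Λ C1, ⟨inferInstanceAs (Module.Finite Λ (F ⧸ LinearMap.range v1)),
    ModuleCat.of Λ (C2 × F), inferInstanceAs (Module.Finite Λ ((F ⧸ LinearMap.range v2) × F)),
    X, ModuleCat.of Λ (Q × (F × F)), T, hX, inferInstanceAs (Module.Projective Λ (Q × (F × F))),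
    hT, ⟨?_⟩⟩, F, v1, (LinearMap.range v1).mkQ, hF2, hv1, Submodule.mkQ_surjective _,
    exact_mkQ_range v1, hv1x⟩
  let D := F ⧸ LinearMap.range v
  have e1 : (X × (Q × (F × F))) ≃ₗ[Λ] ((X × Q) × (F × F)) :=
    (LinearEquiv.prodAssoc Λ _ _ _).symm
  have e2 : ((X × Q) × (F × F)) ≃ₗ[Λ] ((D × T) × (F × F)) :=
    LinearEquiv.prodCongr f (LinearEquiv.refl _ _)
  have e3 : ((D × T) × (F × F)) ≃ₗ[Λ] (D × (T × (F × F))) := LinearEquiv.prodAssoc Λ _ _ _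
  have e4 : (D × (T × (F × F))) ≃ₗ[Λ] (D × ((F × F) × T)) :=
    LinearEquiv.prodCongr (LinearEquiv.refl _ _) (LinearEquiv.prodComm Λ _ _)
  have e5 : (D × ((F × F) × T)) ≃ₗ[Λ] ((D × (F × F)) × T) :=
    (LinearEquiv.prodAssoc Λ _ _ _).symm
  have e6 : ((D × (F × F)) × T) ≃ₗ[Λ] (((C1 × C2) × F) × T) :=
    LinearEquiv.prodCongr g (LinearEquiv.refl _ _)
  have e7 : (((C1 × C2) × F) × T) ≃ₗ[Λ] ((C1 × (C2 × F)) × T) :=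
    LinearEquiv.prodCongr (LinearEquiv.prodAssoc Λ _ _ _) (LinearEquiv.refl _ _)
  exact e1.trans (e2.trans (e3.trans (e4.trans (e5.trans (e6.trans e7)))))

theorem gp_summand [IsSemiprimaryRing Λ] {E A B : Type u} [AddCommGroup E] [Module Λ E]
    [AddCommGroup A] [Module Λ A] [AddCommGroup B] [Module Λ B] [Module.Finite Λ E]
    (hE : IsGorensteinProjective Λ E) (e : E ≃ₗ[Λ] (A × B)) : IsGorensteinProjective Λ A := by
  rw [gp_iff] at hE ⊢
  exact ⟨hE.1.summand (Q := PUnit.{u + 1}) (N' := B) (e.symm.trans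
    { toFun := fun x => (x, 0), invFun := fun z => z.1, map_add' := fun _ _ => rfl,
      map_smul' := fun _ _ => rfl, left_inv := fun _ => rfl, right_inv := fun _ => rfl }),
    hE.2.summand e⟩

theorem hasLength_of_finite [IsArtinianRing Λ] (M : Type u) [AddCommGroup M] [Module Λ M]
    [Module.Finite Λ M] : ∃ n, HasLength Λ M n := by
  have h1 : IsArtinian Λ M := inferInstance
  have h2 : IsNoetherian Λ M := inferInstance
  obtain ⟨s, hs1, hs2⟩ := exists_compositionSeries_of_isNoetherian_isArtinian Λ M
  exact ⟨s.length, s.toFun, hs1, hs2, fun i => s.step i⟩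

theorem finite_of_hasLength (M : Type u) [AddCommGroup M] [Module Λ M]
    (h : ∃ n, HasLength Λ M n) : Module.Finite Λ M := by
  obtain ⟨n, c, h0, h1, h2⟩ := h
  have : IsFiniteLength Λ M := by
    rw [isFiniteLength_iff_exists_compositionSeries]
    exact ⟨⟨n, c, h2⟩, h0, h1⟩
  rw [isFiniteLength_iff_isNoetherian_isArtinian] at this
  have := this.1
  infer_instance

section Uni
variable {M N : Type u} [AddCommGroup M] [Module Λ M] [AddCommGroup N] [Module Λ N]

theorem IsUniserialMod.of_surj (h : IsUniserialMod Λ M) (f : M →ₗ[Λ] N)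
    (hf : Function.Surjective f) : IsUniserialMod Λ N := by
  intro A B
  rcases h (A.comap f) (B.comap f) with h | h
  · exact Or.inl ((Submodule.comap_le_comap_iff_of_surjective hf).1 h)
  · exact Or.inr ((Submodule.comap_le_comap_iff_of_surjective hf).1 h)

theorem IsUniserialMod.of_inj (h : IsUniserialMod Λ N) (f : M →ₗ[Λ] N)
    (hf : Function.Injective f) : IsUniserialMod Λ M := by
  intro A B
  rcases h (A.map f) (B.map f) with h | h
  · exact Or.inl ((Submodule.map_le_map_iff_of_injective hf _ _).1 h)
  · exact Or.inr ((Submodule.map_le_map_iff_of_injective hf _ _).1 h)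

/-- A split mono into a uniserial module is zero or an isomorphism. -/
theorem IsUniserialMod.retract (h : IsUniserialMod Λ N) (i : M →ₗ[Λ] N) (r : N →ₗ[Λ] M)
    (hr : r ∘ₗ i = LinearMap.id) [Nontrivial M] : LinearMap.range i = ⊤ := by
  have hri : ∀ x, r (i x) = x := fun x => LinearMap.congr_fun hr x
  rcases h (LinearMap.range i) (LinearMap.ker r) with h | h
  · exfalso
    obtain ⟨x, hx⟩ := exists_ne (0 : M)
    exact hx ((hri x).symm.trans (h ⟨x, rfl⟩))
  · rw [eq_top_iff]
    intro y _
    have : y - i (r y) ∈ LinearMap.ker r := by simp [hri]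
    obtain ⟨z, hz⟩ := h this
    exact ⟨z + r y, by rw [map_add, hz]; abel⟩

theorem IsUniserialMod.indec (h : IsUniserialMod Λ M) {A B : Submodule Λ M}
    (hc : IsCompl A B) : A = ⊥ ∨ B = ⊥ := by
  rcases h A B with h | h
  · left; rw [← hc.inf_eq_bot, inf_eq_left.2 h]
  · right; rw [← hc.inf_eq_bot, inf_eq_right.2 h]

end Uni

/-- A finite uniserial module over a Nakayama algebra is a quotient of a uniserial
finitely generated projective. -/
theorem exists_uniserial_cover [hN : IsNakayama Λ] (M : Type u) [AddCommGroup M] [Module Λ M]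
    [Module.Finite Λ M] [Nontrivial M] (hM : IsUniserialMod Λ M) :
    ∃ (P : ModuleCat.{u} Λ) (p : P →ₗ[Λ] M), Module.Projective Λ P ∧ Module.Finite Λ P ∧
      IsUniserialMod Λ P ∧ Function.Surjective p := by
  have := hN.artinian
  obtain ⟨n, f, hf⟩ := Module.Finite.exists_fin' Λ M
  have : IsArtinian Λ (Fin n → Λ) := inferInstance
  have : IsNoetherian Λ (Fin n → Λ) := inferInstance
  let S : Set (Submodule Λ (Fin n → Λ)) := {A | Module.Projective Λ A ∧ A.map f = ⊤}
  have hS : S.Nonempty := by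
    refine ⟨⊤, Module.Projective.of_equiv (Submodule.topEquiv (R := Λ) (M := Fin n → Λ)).symm, ?_⟩
    rw [Submodule.map_top, LinearMap.range_eq_top.2 hf]
  obtain ⟨A, ⟨hA1, hA2⟩, hmin⟩ := WellFounded.has_min
    (wellFounded_lt (α := Submodule Λ (Fin n → Λ))) S hS
  have hfin : Module.Finite Λ A := inferInstance
  have hsurj : Function.Surjective (f ∘ₗ A.subtype) := by
    rw [← LinearMap.range_eq_top, LinearMap.range_comp, Submodule.range_subtype, hA2]
  have key : ∀ B C : Submodule Λ A, IsCompl B C →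
      B.map (f ∘ₗ A.subtype) = ⊤ → C = ⊥ := by
    intro B C hBC hB
    have hp : Module.Projective Λ B := by
      refine Module.Projective.of_split B.subtype (Submodule.projectionOnto B C hBC) ?_
      ext x; simp
    have hB' : B.map A.subtype ∈ S := by
      refine ⟨?_, ?_⟩
      · exact Module.Projective.of_equiv
          (Submodule.equivMapOfInjective A.subtype A.injective_subtype B)
      · rw [← Submodule.map_comp, hB]
    have := hmin _ hB'
    have hle : B.map A.subtype ≤ A := Submodule.map_subtype_le A B
    have heq : B.map A.subtype = A := by
      by_contra hne
      exact this (lt_of_le_of_ne hle hne)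
    have hBt : B = ⊤ := by
      apply Submodule.map_injective_of_injective A.injective_subtype
      rw [heq, Submodule.map_subtype_top]
    subst hBt
    simpa using hBC.inf_eq_bot
  have hnt : Nontrivial A := hsurj.nontrivial
  have huni : IsUniserialMod Λ A := by
    refine hN.serial A (hasLength_of_finite A) ⟨hnt, fun B C hBC => ?_⟩
    have hsup : B.map (f ∘ₗ A.subtype) ⊔ C.map (f ∘ₗ A.subtype) = ⊤ := by
      rw [← Submodule.map_sup, hBC.sup_eq_top, Submodule.map_top, LinearMap.range_eq_top.2 hsurj]
    rcases hM (B.map (f ∘ₗ A.subtype)) (C.map (f ∘ₗ A.subtype)) with h | h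
    · left
      rw [sup_eq_right.2 h] at hsup
      exact key C B hBC.symm hsup
    · right
      rw [sup_eq_left.2 h] at hsup
      exact key B C hBC hsup
  exact ⟨ModuleCat.of Λ A, f ∘ₗ A.subtype, hA1, hfin, huni, hsurj⟩

theorem IsElementary.uniserial [hN : IsNakayama Λ] {E : Type u} [AddCommGroup E] [Module Λ E]
    (hE : IsElementary Λ E) : IsUniserialMod Λ E := by
  have := hN.artinian
  obtain ⟨h1, h2, h3, h4, h5⟩ := hE
  have := finite_of_hasLength E h2
  refine hN.serial E h2 ⟨h1, fun N N' hc => ?_⟩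
  by_contra hcon
  push Not at hcon
  refine h5 N hcon.1 ?_ ?_
  · rintro rfl
    exact hcon.2 (by simpa using hc.inf_eq_bot)
  · have e1 : (N' × N) ≃ₗ[Λ] E := Submodule.prodEquivOfIsCompl N' N hc.symm
    have e2 : (E ⧸ N) ≃ₗ[Λ] N' := Submodule.quotientEquivOfIsCompl N N' hc
    have := gp_summand (A := N') (B := N) h3 e1.symm
    exact gp_congr e2.symm this

/-- A Gorenstein projective, non-projective uniserial module has an elementary quotient. -/
theorem exists_elementary_quotient [hN : IsNakayama Λ] (K : Type u) [AddCommGroup K]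
    [Module Λ K] [Module.Finite Λ K] (hu : IsUniserialMod Λ K) (hnt : Nontrivial K)
    (hK : IsGorensteinProjective Λ K) (hnp : ¬ Module.Projective Λ K) :
    ∃ N : Submodule Λ K, IsElementary Λ (K ⧸ N) := by
  have := hN.artinian
  have : IsNoetherian Λ K := inferInstance
  let S : Set (Submodule Λ K) := {N | N ≠ ⊤ ∧ IsGorensteinProjective Λ (K ⧸ N)}
  have hS : S.Nonempty :=
    ⟨⊥, bot_ne_top, gp_congr (Submodule.quotEquivOfEqBot (⊥ : Submodule Λ K) rfl).symm hK⟩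
  obtain ⟨N, ⟨hN1, hN2⟩, hmax⟩ := WellFounded.has_min
    (wellFounded_gt (α := Submodule Λ K)) S hS
  refine ⟨N, Submodule.Quotient.nontrivial_iff.2 hN1, hasLength_of_finite _, hN2, ?_, ?_⟩
  · intro hp
    obtain ⟨s, hs⟩ := Module.projective_lifting_property N.mkQ LinearMap.id N.mkQ_surjective
    have : Nontrivial (K ⧸ N) := Submodule.Quotient.nontrivial_iff.2 hN1
    have hr := hu.retract s N.mkQ hs
    have hinj : Function.Injective s := by
      intro x y hxy
      have h1 := LinearMap.congr_fun hs x
      have h2 := LinearMap.congr_fun hs y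
      simp only [LinearMap.comp_apply, LinearMap.id_apply] at h1 h2
      rw [← h1, ← h2, hxy]
    exact hnp (Module.Projective.of_equiv
      (LinearEquiv.ofBijective s ⟨hinj, LinearMap.range_eq_top.1 hr⟩))
  · intro A hA1 hA2 hA
    let f : K →ₗ[Λ] ((K ⧸ N) ⧸ A) := A.mkQ ∘ₗ N.mkQ
    have hf : Function.Surjective f := A.mkQ_surjective.comp N.mkQ_surjective
    have hker : LinearMap.ker f = A.comap N.mkQ := by
      rw [LinearMap.ker_comp, Submodule.ker_mkQ]
    refine hmax (A.comap N.mkQ) ⟨?_, ?_⟩ ?_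
    · intro h
      apply hA2
      rw [← Submodule.map_comap_eq_of_surjective N.mkQ_surjective A, h, Submodule.map_top,
        Submodule.range_mkQ]
    · rw [← hker]
      exact gp_congr (f.quotKerEquivOfSurjective hf).symm hA
    · refine lt_of_le_of_ne ?_ ?_
      · intro x hx
        have : N.mkQ x = 0 := by simpa using hx
        rw [Submodule.mem_comap, this]; exact A.zero_mem
      · intro h
        apply hA1
        rw [← Submodule.map_comap_eq_of_surjective N.mkQ_surjective A, ← h]
        exact Submodule.mkQ_map_self N

/-- In a length two module with simple top and simple socle, radical equals socle. -/
theorem length_two {L V T : Type u} [AddCommGroup L] [Module Λ L] [AddCommGroup V] [Module Λ V]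
    [AddCommGroup T] [Module Λ T] (hV : IsSimpleModule Λ V) (hT : IsSimpleModule Λ T)
    (hL : HasLength Λ L 2) (pL : L →ₗ[Λ] V) (hp : Function.Surjective pL)
    (hk : LinearMap.ker pL = modRadical Λ L) (i : T →ₗ[Λ] L) (hi : Function.Injective i)
    (hr : LinearMap.range i = modSocle Λ L) : LinearMap.range i = LinearMap.ker pL := by
  obtain ⟨c, h0, h1, h2⟩ := hL
  have a1 : IsAtom (c 1) := by
    have := h2 0
    rw [← bot_covBy_iff]
    change c 0 ⋖ c 1 at this
    rwa [h0] at this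
  have a2 : IsCoatom (c 1) := by
    have := h2 1
    rw [← covBy_top_iff]
    change c 1 ⋖ c (Fin.last 2) at this
    rwa [h1] at this
  have hat : IsAtom (LinearMap.range i) := by
    rw [← isSimpleModule_iff_isAtom]
    exact IsSimpleModule.congr (LinearEquiv.ofInjective i hi).symm
  have hco : IsCoatom (LinearMap.ker pL) := by
    rw [← isSimpleModule_iff_isCoatom]
    exact IsSimpleModule.congr (pL.quotKerEquivOfSurjective hp)
  have e1 : c 1 = LinearMap.range i := by
    have hle : c 1 ≤ LinearMap.range i := by
      rw [hr]; exact le_sSup a1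
    exact (hat.le_iff.1 hle).resolve_left a1.1
  have e2 : LinearMap.ker pL = c 1 := by
    have hle : LinearMap.ker pL ≤ c 1 := by
      rw [hk]; exact sInf_le a2
    exact ((hco.le_iff.1 hle).resolve_left a2.1).symm
  rw [e2, e1]

theorem top_claim [hN : IsNakayama Λ] {E P : Type u} [AddCommGroup E] [Module Λ E]
    [AddCommGroup P] [Module Λ P] (hPu : IsUniserialMod Λ P) (p : P →ₗ[Λ] E)
    (hp : Function.Surjective p) (N : Submodule Λ (LinearMap.ker p))
    (hNt : Nontrivial (LinearMap.ker p ⧸ N))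
    (V T : Type u) [AddCommGroup V] [Module Λ V] [AddCommGroup T] [Module Λ T]
    (hV : IsSimpleModule Λ V) (hs : IsSocleOf Λ V E) (ht : IsTauOf Λ T V) :
    IsTopOf Λ T (LinearMap.ker p ⧸ N) := by
  have := hN.artinian
  obtain ⟨iV, hiV, -⟩ := hs
  obtain ⟨-, hT, L, hL, ⟨-, pL, hpL, hkL⟩, i, hi, hri⟩ := ht
  have hrk := length_two hV hT hL pL hpL hkL i hi hri
  have hLfin : Module.Finite Λ L := finite_of_hasLength L ⟨2, hL⟩
  have hVnt : Nontrivial V := IsSimpleModule.nontrivial Λ V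
  have hVfin : Module.Finite Λ V := Module.Finite.of_surjective pL hpL
  have hVu : IsUniserialMod Λ V := by
    intro A B
    rcases eq_bot_or_eq_top A with h | h
    · left; rw [h]; exact bot_le
    · right; rw [h]; exact le_top
  obtain ⟨Q, q, hQ1, hQ2, hQu, hq⟩ := exists_uniserial_cover V hVu
  obtain ⟨g, hg⟩ := Module.projective_lifting_property pL q hpL
  have hg' : ∀ x, pL (g x) = q x := fun x => LinearMap.congr_fun hg x
  have hgt : LinearMap.range g = ⊤ := by
    rcases eq_top_or_exists_le_coatom (LinearMap.range g) with h | ⟨C, hC, hle⟩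
    · exact h
    · exfalso
      apply hC.1
      have hk : LinearMap.ker pL ≤ C := by rw [hkL]; exact sInf_le hC
      rw [eq_top_iff]
      intro y _
      obtain ⟨x, hx⟩ := hq (pL y)
      have h1 : y - g x ∈ LinearMap.ker pL := by simp [hg', hx]
      have h2 := C.add_mem (hk h1) (hle ⟨x, rfl⟩)
      simpa using h2
  have hgs := LinearMap.range_eq_top.1 hgt
  have heT : Function.Exact i pL := by
    rw [LinearMap.exact_iff]; exact hrk.symm
  obtain ⟨b, hb⟩ := lift_exact hi heT (g ∘ₗ (LinearMap.ker q).subtype) (by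
    ext x
    simp [hg'])
  have hb' : ∀ x, i (b x) = g x.1 := fun x => LinearMap.congr_fun hb x
  have hbs : Function.Surjective b := by
    intro t
    obtain ⟨x, hx⟩ := hgs (i t)
    have hxq : x ∈ LinearMap.ker q := by
      rw [LinearMap.mem_ker, ← hg', hx]
      exact (heT (i t)).2 ⟨t, rfl⟩
    exact ⟨⟨x, hxq⟩, hi (by rw [hb', hx])⟩
  obtain ⟨h, hh⟩ := Module.projective_lifting_property p (iV ∘ₗ q) hp
  have hh' : ∀ x, p (h x) = iV (q x) := fun x => LinearMap.congr_fun hh x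
  have hK : LinearMap.ker p ≤ LinearMap.range h := by
    rcases hPu (LinearMap.ker p) (LinearMap.range h) with h1 | h1
    · exact h1
    · exfalso
      obtain ⟨v, hv⟩ := exists_ne (0 : V)
      obtain ⟨x, hx⟩ := hq v
      have h2 : p (h x) = 0 := h1 ⟨x, rfl⟩
      rw [hh', hx] at h2
      exact hv (hiV (by rw [h2, map_zero]))
  have heK : Function.Exact (LinearMap.ker p).subtype p := by
    rw [LinearMap.exact_iff, Submodule.range_subtype]
  obtain ⟨a0, ha0⟩ := lift_exact (LinearMap.ker p).injective_subtype heK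
    (h ∘ₗ (LinearMap.ker q).subtype) (by
      ext x
      simp [hh'])
  have ha0' : ∀ x, ((a0 x : LinearMap.ker p) : P) = h x.1 := fun x => LinearMap.congr_fun ha0 x
  have ha0s : Function.Surjective a0 := by
    rintro ⟨y, hy⟩
    obtain ⟨x, hx⟩ := hK hy
    have hxq : x ∈ LinearMap.ker q := by
      rw [LinearMap.mem_ker]
      apply hiV
      rw [← hh', hx, map_zero]
      exact hy
    exact ⟨⟨x, hxq⟩, Subtype.ext (by rw [ha0', hx])⟩
  have hQ1u : IsUniserialMod Λ (LinearMap.ker q) :=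
    hQu.of_inj _ (LinearMap.ker q).injective_subtype
  let a : LinearMap.ker q →ₗ[Λ] (LinearMap.ker p ⧸ N) := N.mkQ ∘ₗ a0
  have has : Function.Surjective a := N.mkQ_surjective.comp ha0s
  have hbco : IsCoatom (LinearMap.ker b) := by
    rw [← isSimpleModule_iff_isCoatom]
    exact IsSimpleModule.congr (b.quotKerEquivOfSurjective hbs)
  have hab : LinearMap.ker a ≤ LinearMap.ker b := by
    rcases hQ1u (LinearMap.ker a) (LinearMap.ker b) with h1 | h1
    · exact h1
    · rcases hbco.le_iff.1 h1 with h2 | h2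
      · exfalso
        rw [LinearMap.ker_eq_top] at h2
        obtain ⟨y, hy⟩ := exists_ne (0 : LinearMap.ker p ⧸ N)
        obtain ⟨x, hx⟩ := has y
        exact hy (by rw [← hx, h2]; rfl)
      · exact h2.le
  obtain ⟨p', hp'⟩ := factor_surj has b hab
  have hp's : Function.Surjective p' := by
    intro t
    obtain ⟨x, hx⟩ := hbs t
    exact ⟨a x, by rw [← hx, ← hp']; rfl⟩
  refine ⟨hT, p', hp's, ?_⟩
  have hco : IsCoatom (LinearMap.ker p') := by
    rw [← isSimpleModule_iff_isCoatom]
    exact IsSimpleModule.congr (p'.quotKerEquivOfSurjective hp's)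
  have hEu : IsUniserialMod Λ (LinearMap.ker p ⧸ N) := hQ1u.of_surj a has
  apply le_antisymm
  · refine le_sInf fun C hC => ?_
    rcases hEu (LinearMap.ker p') C with h1 | h1
    · exact h1
    · exact ((hC.le_iff.1 h1).resolve_left hco.1).le
  · exact sInf_le hco

/-- The pushout of the projective presentation along the elementary quotient does not split. -/
theorem nonsplit_claim {E P : Type u} [AddCommGroup E] [Module Λ E]
    [AddCommGroup P] [Module Λ P] (hPu : IsUniserialMod Λ P) (p : P →ₗ[Λ] E)
    (hp : Function.Surjective p) (hEnt : Nontrivial E) (N : Submodule Λ (LinearMap.ker p))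
    (hNt : Nontrivial (LinearMap.ker p ⧸ N)) :
    ∃ (X : ModuleCat.{u} Λ) (ι : (LinearMap.ker p ⧸ N) →ₗ[Λ] X) (π : (X : Type u) →ₗ[Λ] E),
        Function.Injective ι ∧ Function.Surjective π ∧ Function.Exact ι π ∧
        ¬ ∃ r : (X : Type u) →ₗ[Λ] (LinearMap.ker p ⧸ N), r.comp ι = LinearMap.id := by
  let N' : Submodule Λ P := N.map (LinearMap.ker p).subtype
  have hN' : N' ≤ LinearMap.ker p := Submodule.map_subtype_le _ _
  let ι : (LinearMap.ker p ⧸ N) →ₗ[Λ] (P ⧸ N') :=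
    N.mapQ N' (LinearMap.ker p).subtype (Submodule.le_comap_map _ _)
  let π : (P ⧸ N') →ₗ[Λ] E := N'.liftQ p hN'
  have hι : ∀ x, ι (N.mkQ x) = N'.mkQ x.1 := fun x => rfl
  have hπ : ∀ x, π (N'.mkQ x) = p x := fun x => rfl
  have hinj : Function.Injective ι := by
    rw [injective_iff_map_eq_zero]
    intro y hy
    obtain ⟨x, rfl⟩ := N.mkQ_surjective y
    rw [hι, Submodule.mkQ_apply, Submodule.Quotient.mk_eq_zero] at hy
    obtain ⟨z, hz, hzx⟩ := hy
    have : z = x := Subtype.ext hzx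
    subst this
    rw [Submodule.mkQ_apply, Submodule.Quotient.mk_eq_zero]
    exact hz
  have hsurj : Function.Surjective π := by
    intro e
    obtain ⟨x, hx⟩ := hp e
    exact ⟨N'.mkQ x, by rw [hπ, hx]⟩
  have hex : Function.Exact ι π := by
    intro y
    constructor
    · intro hy
      obtain ⟨x, rfl⟩ := N'.mkQ_surjective y
      rw [hπ] at hy
      exact ⟨N.mkQ ⟨x, hy⟩, hι _⟩
    · rintro ⟨z, rfl⟩
      obtain ⟨x, rfl⟩ := N.mkQ_surjective z
      rw [hι, hπ]
      exact x.2
  refine ⟨ModuleCat.of Λ (P ⧸ N'), ι, π, hinj, hsurj, hex, ?_⟩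
  rintro ⟨r, hr⟩
  have hXu : IsUniserialMod Λ (P ⧸ N') := hPu.of_surj N'.mkQ N'.mkQ_surjective
  have htop := LinearMap.range_eq_top.1 (hXu.retract ι r hr)
  obtain ⟨e, he⟩ := exists_ne (0 : E)
  obtain ⟨x, hx⟩ := hsurj e
  exact he (hx.symm.trans ((hex x).2 (htop x)))

end Helpers

/-- If `E` is an elementary Gorenstein projective module over a Nakayama algebra without
simple projectives, there exists an elementary module `E'` with `top E' = τ soc E` and
`Ext¹(E, E') ≠ 0` (i.e. there is a non-split extension of `E` by `E'`). -/
theorem exists_elementary_successor [IsNakayama Λ] (h0 : NoSimpleProjectives Λ)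
    (E : Type u) [AddCommGroup E] [Module Λ E] (hE : IsElementary Λ E) :
    ∃ E' : ModuleCat.{u} Λ, IsElementary Λ E' ∧
      (∀ (V T : Type u) [AddCommGroup V] [Module Λ V] [AddCommGroup T] [Module Λ T],
        IsSimpleModule Λ V → IsSocleOf Λ V E → IsTauOf Λ T V → IsTopOf Λ T E') ∧
      ∃ (X : ModuleCat.{u} Λ) (ι : (E' : Type u) →ₗ[Λ] X) (π : (X : Type u) →ₗ[Λ] E),
        Function.Injective ι ∧ Function.Surjective π ∧ Function.Exact ι π ∧
        ¬ ∃ r : (X : Type u) →ₗ[Λ] E', r.comp ι = LinearMap.id := by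
  have hN : IsNakayama Λ := inferInstance
  have := hN.artinian
  have hEu := hE.uniserial
  obtain ⟨hEnt, hElen, hEgp, hEnp, -⟩ := hE
  have hEfin := finite_of_hasLength E hElen
  obtain ⟨P, p, hP1, hP2, hPu, hp⟩ := exists_uniserial_cover E hEu
  obtain ⟨hext, hKgp⟩ := gp_syzygy hEgp p hp
  have hKu : IsUniserialMod Λ (LinearMap.ker p) :=
    hPu.of_inj _ (LinearMap.ker p).injective_subtype
  have hKfin : Module.Finite Λ (LinearMap.ker p) := inferInstance
  have hKnt : Nontrivial (LinearMap.ker p) := by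
    rw [Submodule.nontrivial_iff_ne_bot]
    intro h
    exact hEnp (Module.Projective.of_equiv
      (LinearEquiv.ofBijective p ⟨LinearMap.ker_eq_bot.1 h, hp⟩))
  have hKnp : ¬ Module.Projective Λ (LinearMap.ker p) := by
    intro hproj
    obtain ⟨r, hr⟩ := hext.extend (F := LinearMap.ker p) LinearMap.id
    have htop := hPu.retract (LinearMap.ker p).subtype r hr
    rw [Submodule.range_subtype] at htop
    obtain ⟨e, he⟩ := exists_ne (0 : E)
    obtain ⟨x, hx⟩ := hp e
    have hx0 : x ∈ LinearMap.ker p := by rw [htop]; trivial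
    exact he (hx.symm.trans hx0)
  obtain ⟨N, hNel⟩ := exists_elementary_quotient (LinearMap.ker p) hKu hKnt hKgp hKnp
  have hNt := hNel.1
  refine ⟨ModuleCat.of Λ (LinearMap.ker p ⧸ N), hNel, ?_, ?_⟩
  · intro V T _ _ _ _ hV hs ht
    exact top_claim hPu p hp N hNt V T hV hs ht
  · exact nonsplit_claim hPu p hp hEnt N hNt
end
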